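/- Let n ≥ 2, s ≥ n+3, and suppose the linear system L = L_{n,d}(m_1,…,m_s) of degree-d hypersurfaces with multiplicity at least m_i at s points on the rational normal curve is nonzero (effective) and non-redundant (m_i ≥ k_C for every i). Then dim L = Σ (−1)^{|I|} · F_t(n + k_{I,t} − r_{I,t} − 1, s, ε, n), where the sum ranges over all integers t with 0 ≤ 2t ≤ n and all subsets I ⊆ {1,…,s} with |I| ≤ n − 2t. -/

import Mathlib

open Finset

noncomputable section

/-- Binomial coefficient `C(a,k)` with integer arguments; zero if `k < 0` or `a < k`. -/
def Cb (a k : ℤ) : ℤ := if 0 ≤ k ∧ k ≤ a then (Nat.choose a.toNat k.toNat : ℤ) else 0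

/-- The recursively defined function `F_t(a, s, ε, n)`. -/
def Fb : ℕ → ℤ → ℕ → ℕ → ℤ → ℤ
  | 0, a, _, _, n => Cb a n
  | (t+1), a, s, e, n =>
      if n < 0 then 0 else
      Cb a n
        + ∑ j ∈ Finset.range (t+1), Cb ((s : ℤ) - n - 4 + (j+1)) (j+1) * Cb (a + (j+1)) n
        - ∑ j ∈ Finset.range (t+1), Cb (e : ℤ) (j+1) * Fb (t - j) a s e (n - (j+1))
  termination_by t _ _ _ _ => t
  decreasing_by omega

/-- Iterated partial derivative along a list of coordinate directions, as a linear map. -/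
def derivAlong {n : ℕ} (D : List (Fin (n+1))) :
    MvPolynomial (Fin (n+1)) ℂ →ₗ[ℂ] MvPolynomial (Fin (n+1)) ℂ :=
  D.foldr (fun j f => (MvPolynomial.pderiv j).toLinearMap.comp f) LinearMap.id

/-- The point `(1, u, u², …, uⁿ) ∈ ℂ^{n+1}` on the affine cone over the
rational normal curve of degree `n`. -/
def rncPoint (n : ℕ) (u : ℂ) : Fin (n+1) → ℂ := fun j => u ^ (j : ℕ)

/-- The linear system `L_{n,d}(m_1,…,m_s)`: homogeneous polynomials of degree `d`
in `x_0,…,x_n` all of whose partial derivatives of total order `≤ m_i − 1`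
vanish at the point `p_i = (1, t_i, …, t_iⁿ)`. -/
def linSys (n d s : ℕ) (m : Fin s → ℕ) (tp : Fin s → ℂ) :
    Submodule ℂ (MvPolynomial (Fin (n+1)) ℂ) :=
  MvPolynomial.homogeneousSubmodule (Fin (n+1)) ℂ d ⊓
    ⨅ (i : Fin s), ⨅ (D : List (Fin (n+1))), ⨅ (_ : D.length < m i),
      LinearMap.ker
        ((MvPolynomial.aeval (rncPoint n (tp i))).toLinearMap.comp (derivAlong D))

/-- `k_C = ⌈(m_1+⋯+m_s − nd)/(s−n−2)⌉`. -/
def kC (n d s : ℕ) (m : Fin s → ℕ) : ℤ :=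
  ⌈((∑ i, (m i : ℚ)) - (n : ℚ) * d) / ((s : ℚ) - n - 2)⌉



abbrev RV (v : ℕ) := MvPolynomial (Fin v) ℂ

def ell (v : ℕ) (u : ℂ) : RV v := ∑ j : Fin v, MvPolynomial.C (u ^ (j : ℕ)) * MvPolynomial.X j

lemma ell_hom (v : ℕ) (u : ℂ) : (ell v u).IsHomogeneous 1 := by
  unfold ell
  apply MvPolynomial.IsHomogeneous.sum
  intro j _
  exact MvPolynomial.IsHomogeneous.C_mul (MvPolynomial.isHomogeneous_X _ _) _

lemma dual_ext {v : ℕ} {l : Module.Dual ℂ (RV v)}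
    (h : ∀ m, l (MvPolynomial.monomial m 1) = 0) : l = 0 := by
  refine LinearMap.ext fun f => ?_
  rw [LinearMap.zero_apply]
  induction f using MvPolynomial.induction_on' with
  | monomial m c =>
    have : MvPolynomial.monomial m c = c • MvPolynomial.monomial m (1:ℂ) := by
      rw [MvPolynomial.smul_monomial]; simp
    rw [this, map_smul, h, smul_zero]
  | add f g hf hg => rw [map_add, hf, hg, add_zero]

/-- functionals concentrated in degree `d` -/
def Conc (v d : ℕ) : Submodule ℂ (Module.Dual ℂ (RV v)) where
  carrier := {l | ∀ f e, f.IsHomogeneous e → e ≠ d → l f = 0}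
  zero_mem' := by intro f e _ _; rfl
  add_mem' := by
    intro a b ha hb f e h1 h2
    simp [ha f e h1 h2, hb f e h1 h2]
  smul_mem' := by
    intro c a ha f e h1 h2
    simp [ha f e h1 h2]

def Wd (v d : ℕ) (S : Finset ℂ) (a : ℂ → ℕ) : Submodule ℂ (Module.Dual ℂ (RV v)) where
  carrier := {l | l ∈ Conc v d ∧ ∀ t ∈ S, ∀ f, l (ell v t ^ a t * f) = 0}
  zero_mem' := ⟨(Conc v d).zero_mem, by intro t _ f; rfl⟩
  add_mem' := by
    intro a b ha hb
    refine ⟨(Conc v d).add_mem ha.1 hb.1, ?_⟩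
    intro t ht f
    simp [ha.2 t ht f, hb.2 t ht f]
  smul_mem' := by
    intro c a ha
    refine ⟨(Conc v d).smul_mem c ha.1, ?_⟩
    intro t ht f
    simp [ha.2 t ht f]

lemma mem_Wd {v d : ℕ} {S : Finset ℂ} {a : ℂ → ℕ} {l : Module.Dual ℂ (RV v)} :
    l ∈ Wd v d S a ↔ l ∈ Conc v d ∧ ∀ t ∈ S, ∀ f, l (ell v t ^ a t * f) = 0 := Iff.rfl

lemma conc_ext {v d : ℕ} {l : Module.Dual ℂ (RV v)} (hl : l ∈ Conc v d)
    (h : ∀ f, f.IsHomogeneous d → l f = 0) : l = 0 := by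
  apply dual_ext
  intro m
  by_cases hm : m.degree = d
  · exact h _ (MvPolynomial.isHomogeneous_monomial _ hm)
  · exact hl _ _ (MvPolynomial.isHomogeneous_monomial _ rfl) hm

lemma conc_gt {v d : ℕ} {l : Module.Dual ℂ (RV v)} (hl : l ∈ Conc v d)
    {g : RV v} {e : ℕ} (hg : g.IsHomogeneous e) (he : d < e) (f : RV v) : l (g * f) = 0 := by
  rw [← MvPolynomial.sum_homogeneousComponent f, Finset.mul_sum, map_sum]
  apply Finset.sum_eq_zero
  intro i _
  exact hl _ _ (hg.mul (MvPolynomial.homogeneousComponent_isHomogeneous i f)) (by omega)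

/-- multiply-by-g functional -/
def mulF {v : ℕ} (l : Module.Dual ℂ (RV v)) (g : RV v) : Module.Dual ℂ (RV v) :=
  l.comp (LinearMap.mulLeft ℂ g)

@[simp] lemma mulF_apply {v : ℕ} (l : Module.Dual ℂ (RV v)) (g f : RV v) :
    mulF l g f = l (g * f) := rfl

lemma mulF_conc {v d e : ℕ} {l : Module.Dual ℂ (RV v)} (hl : l ∈ Conc v d)
    {g : RV v} (hg : g.IsHomogeneous e) (he : e ≤ d) : mulF l g ∈ Conc v (d - e) := by
  intro f e' hf he'
  exact hl _ _ (hg.mul hf) (by omega)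

lemma ell_pow_hom (v : ℕ) (u : ℂ) (e : ℕ) : (ell v u ^ e).IsHomogeneous e := by
  simpa using (ell_hom v u).pow e

/-- monomial exponents of degree d -/
abbrev Ix (v d : ℕ) := {x // x ∈ (Finset.univ : Finset (Fin v)).finsuppAntidiag d}

lemma mem_ix {v d : ℕ} (α : Fin v →₀ ℕ) :
    α ∈ (Finset.univ : Finset (Fin v)).finsuppAntidiag d ↔ α.degree = d := by
  simp [Finset.mem_finsuppAntidiag, Finsupp.degree_eq_sum]

def concToFun (v d : ℕ) : Module.Dual ℂ (RV v) →ₗ[ℂ] (Ix v d → ℂ) where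
  toFun l := fun α => l (MvPolynomial.monomial α.1 1)
  map_add' := by intros; rfl
  map_smul' := by intros; rfl

lemma concToFun_inj {v d : ℕ} {l : Module.Dual ℂ (RV v)} (hl : l ∈ Conc v d)
    (h : concToFun v d l = 0) : l = 0 := by
  apply dual_ext
  intro m
  by_cases hm : m.degree = d
  · have := congrFun h ⟨m, (mem_ix m).2 hm⟩
    simpa [concToFun] using this
  · exact hl _ _ (MvPolynomial.isHomogeneous_monomial _ rfl) hm

def funToConc (v d : ℕ) (c : Ix v d → ℂ) : Module.Dual ℂ (RV v) where
  toFun f := ∑ α : Ix v d, c α * f.coeff α.1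
  map_add' := by intros; simp [mul_add, Finset.sum_add_distrib]
  map_smul' := by intros; simp [Finset.mul_sum, mul_left_comm]

lemma funToConc_mem (v d : ℕ) (c : Ix v d → ℂ) : funToConc v d c ∈ Conc v d := by
  intro f e hf he
  apply Finset.sum_eq_zero
  intro α _
  rw [hf.coeff_eq_zero, mul_zero]
  rw [(mem_ix α.1).1 α.2]; omega

lemma concToFun_funToConc (v d : ℕ) (c : Ix v d → ℂ) : concToFun v d (funToConc v d c) = c := by
  funext β
  change ∑ α : Ix v d, c α * MvPolynomial.coeff α.1 (MvPolynomial.monomial β.1 1) = c β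
  rw [Finset.sum_eq_single β]
  · simp
  · intro α _ hα
    rw [MvPolynomial.coeff_monomial, if_neg, mul_zero]
    intro h; exact hα (Subtype.ext h.symm)
  · simp

def concEquiv (v d : ℕ) : Conc v d ≃ₗ[ℂ] (Ix v d → ℂ) :=
  LinearEquiv.ofBijective ((concToFun v d).comp (Conc v d).subtype) (by
    constructor
    · rw [← LinearMap.ker_eq_bot, LinearMap.ker_eq_bot']
      intro l hl
      exact Subtype.ext (concToFun_inj l.2 hl)
    · intro c
      exact ⟨⟨_, funToConc_mem v d c⟩, concToFun_funToConc v d c⟩)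

instance concFin (v d : ℕ) : Module.Finite ℂ (Conc v d) :=
  Module.Finite.equiv (concEquiv v d).symm

lemma Wd_le_conc (v d : ℕ) (S a) : Wd v d S a ≤ Conc v d := fun _ h => h.1

instance WdFin (v d : ℕ) (S a) : Module.Finite ℂ (Wd v d S a) :=
  Submodule.finiteDimensional_of_le (Wd_le_conc v d S a)

def hW (v d : ℕ) (S : Finset ℂ) (a : ℂ → ℕ) : ℤ := Module.finrank ℂ (Wd v d S a)

lemma hW_mono {v d : ℕ} {S S' : Finset ℂ} {a a' : ℂ → ℕ} (h : Wd v d S a ≤ Wd v d S' a') :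
    hW v d S a ≤ hW v d S' a' := by
  unfold hW
  exact_mod_cast Submodule.finrank_mono h

lemma hW_nonneg (v d : ℕ) (S a) : 0 ≤ hW v d S a := by unfold hW; positivity

lemma Wd_erase_le (v d : ℕ) (S : Finset ℂ) (a) (j : ℂ) : Wd v d S a ≤ Wd v d (S.erase j) a :=
  fun _ h => ⟨h.1, fun t ht f => h.2 t (Finset.mem_of_mem_erase ht) f⟩

/-- geometric series `1/(1-X^c)` -/
def Gs (c : ℕ) : PowerSeries ℤ := PowerSeries.mk fun n => if c ∣ n then 1 else 0

lemma Gs_mul {c : ℕ} (hc : 0 < c) : Gs c * (1 - PowerSeries.X ^ c) = 1 := by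
  ext n
  rw [mul_sub, mul_one, map_sub, PowerSeries.coeff_mul_X_pow', PowerSeries.coeff_one]
  simp only [Gs, PowerSeries.coeff_mk]
  by_cases hcn : c ≤ n
  · have h0 : n ≠ 0 := by omega
    have : c ∣ n - c ↔ c ∣ n := by
      constructor
      · intro h
        have := Nat.dvd_add h (dvd_refl c)
        rwa [Nat.sub_add_cancel hcn] at this
      · intro h
        exact Nat.dvd_sub h (dvd_refl c)
    simp [this, hcn, h0]
  · rw [if_neg hcn]
    by_cases h0 : n = 0
    · simp [h0]
    · rw [if_neg, if_neg h0]; · simp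
      intro h; exact hcn (Nat.le_of_dvd (by omega) h)

def Np (S : Finset ℂ) (a : ℂ → ℕ) : PowerSeries ℤ := ∏ t ∈ S, (1 - PowerSeries.X ^ a t)

def BB (v d : ℕ) (S : Finset ℂ) (a : ℂ → ℕ) (κ p p' : ℕ) : ℤ :=
  PowerSeries.coeff d (Np S a * Gs 1 ^ v * Gs κ ^ p * Gs (κ+1) ^ p')

lemma hConc (v d : ℕ) : (Module.finrank ℂ (Conc v d) : ℤ) = PowerSeries.coeff d (Gs 1 ^ v) := by
  rw [(concEquiv v d).finrank_eq, Module.finrank_fintype_fun_eq_card, Fintype.card_coe]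
  have : (Gs 1 ^ v) = ∏ j : Fin v, Gs 1 := by simp
  rw [this, PowerSeries.coeff_prod]
  simp [Gs]

lemma hW_top (v d : ℕ) (S : Finset ℂ) (a) (h : ∀ t ∈ S, d < a t) :
    hW v d S a = PowerSeries.coeff d (Gs 1 ^ v) := by
  rw [← hConc]
  unfold hW
  have : Wd v d S a = Conc v d := by
    apply le_antisymm (Wd_le_conc v d S a)
    intro l hl
    exact ⟨hl, fun t ht f => conc_gt hl (ell_pow_hom v t _) (h t ht) f⟩
  rw [this]

lemma Np_mod (S : Finset ℂ) (a) (d : ℕ) (h : ∀ t ∈ S, d < a t) :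
    ∃ M, Np S a = 1 + PowerSeries.X ^ (d+1) * M := by
  classical
  induction S using Finset.induction_on with
  | empty => exact ⟨0, by simp [Np]⟩
  | insert x S hx ih =>
    obtain ⟨M, hM⟩ := ih (fun t ht => h t (Finset.mem_insert_of_mem ht))
    unfold Np at hM ⊢
    rw [Finset.prod_insert hx, hM]
    obtain ⟨k, hk⟩ : ∃ k, a x = d + 1 + k := ⟨a x - (d+1), by have := h x (by simp); omega⟩
    refine ⟨M - PowerSeries.X ^ k - PowerSeries.X ^ k * PowerSeries.X ^ (d+1) * M, ?_⟩
    rw [hk, pow_add]; ring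

lemma coeff_Np_top (S : Finset ℂ) (a) (d : ℕ) (h : ∀ t ∈ S, d < a t) (Q : PowerSeries ℤ) :
    PowerSeries.coeff d (Np S a * Q) = PowerSeries.coeff d Q := by
  obtain ⟨M, hM⟩ := Np_mod S a d h
  rw [hM, add_mul, one_mul, map_add, mul_assoc, PowerSeries.coeff_X_pow_mul', if_neg (by omega), add_zero]

lemma coeff_Gs_top (c d k : ℕ) (h : d < c) (Q : PowerSeries ℤ) :
    PowerSeries.coeff d (Q * Gs c ^ k) = PowerSeries.coeff d Q := by
  induction k generalizing Q with
  | zero => simp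
  | succ k ih =>
    rw [pow_succ', ← mul_assoc, ih]
    have h1 : Gs c = 1 + PowerSeries.X ^ c * Gs c := by
      have := Gs_mul (c := c) (by omega)
      linear_combination this
    rw [h1, mul_add, mul_one, map_add, mul_left_comm, PowerSeries.coeff_X_pow_mul', if_neg (by omega), add_zero]

lemma hW_zero (v d : ℕ) (S : Finset ℂ) (a) (t : ℂ) (ht : t ∈ S) (h : a t = 0) : hW v d S a = 0 := by
  have : Wd v d S a = ⊥ := by
    rw [eq_bot_iff]
    intro l hl
    rw [Submodule.mem_bot]
    apply dual_ext
    intro m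
    have := hl.2 t ht (MvPolynomial.monomial m 1)
    simpa [h] using this
  unfold hW
  rw [this]; simp

lemma Np_zero (S : Finset ℂ) (a) (t : ℂ) (ht : t ∈ S) (h : a t = 0) : Np S a = 0 := by
  unfold Np
  exact Finset.prod_eq_zero ht (by simp [h])



/-- coefficientwise application of a functional -/
def tl {v : ℕ} (l : Module.Dual ℂ (RV v)) (F : Polynomial (RV v)) : Polynomial ℂ :=
  ∑ i ∈ Finset.range (F.natDegree + 1), Polynomial.monomial i (l (F.coeff i))

lemma tl_coeff {v : ℕ} (l : Module.Dual ℂ (RV v)) (F : Polynomial (RV v)) (i : ℕ) :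
    (tl l F).coeff i = l (F.coeff i) := by
  unfold tl
  rw [Polynomial.finsetSum_coeff]
  simp only [Polynomial.coeff_monomial]
  rw [Finset.sum_ite_eq']
  split_ifs with h
  · rfl
  · rw [Polynomial.coeff_eq_zero_of_natDegree_lt, map_zero]
    simpa using h

lemma tl_add {v : ℕ} (l : Module.Dual ℂ (RV v)) (F G : Polynomial (RV v)) :
    tl l (F + G) = tl l F + tl l G := by
  ext i; simp [tl_coeff]

lemma tl_sub {v : ℕ} (l : Module.Dual ℂ (RV v)) (F G : Polynomial (RV v)) :
    tl l (F - G) = tl l F - tl l G := by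
  ext i; simp [tl_coeff]

lemma tl_sum {v : ℕ} (l : Module.Dual ℂ (RV v)) {ι : Type*} (s : Finset ι) (F : ι → Polynomial (RV v)) :
    tl l (∑ i ∈ s, F i) = ∑ i ∈ s, tl l (F i) := by
  ext i; simp [tl_coeff]

lemma tl_natmul {v : ℕ} (l : Module.Dual ℂ (RV v)) (k : ℕ) (F : Polynomial (RV v)) :
    tl l (k * F) = k * tl l F := by
  ext i
  rw [tl_coeff, ← nsmul_eq_mul, ← nsmul_eq_mul, Polynomial.coeff_smul, Polynomial.coeff_smul, map_nsmul, tl_coeff]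

lemma tl_X_sub_C {v : ℕ} (l : Module.Dual ℂ (RV v)) (F : Polynomial (RV v)) (t : ℂ) :
    tl l ((Polynomial.X - Polynomial.C (MvPolynomial.C t)) * F) = (Polynomial.X - Polynomial.C t) * tl l F := by
  ext i
  cases i <;> simp [tl_coeff, sub_mul, MvPolynomial.C_mul']

lemma tl_X_sub_C_pow {v : ℕ} (l : Module.Dual ℂ (RV v)) (F : Polynomial (RV v)) (t : ℂ) (m : ℕ) :
    tl l ((Polynomial.X - Polynomial.C (MvPolynomial.C t)) ^ m * F) = (Polynomial.X - Polynomial.C t) ^ m * tl l F := by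
  induction m with
  | zero => simp
  | succ m ih => rw [pow_succ', mul_assoc, tl_X_sub_C, ih, pow_succ', mul_assoc]

lemma tl_eval {v : ℕ} (l : Module.Dual ℂ (RV v)) (F : Polynomial (RV v)) (u : ℂ) :
    (tl l F).eval u = l (F.eval (MvPolynomial.C u)) := by
  rw [Polynomial.eval_eq_sum_range (p := F), map_sum]
  unfold tl
  rw [Polynomial.eval_finsetSum]
  apply Finset.sum_congr rfl
  intro i _
  rw [Polynomial.eval_monomial, ← map_pow, mul_comm (F.coeff i), MvPolynomial.C_mul', map_smul,
    smul_eq_mul, mul_comm]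

lemma tl_natDegree {v : ℕ} (l : Module.Dual ℂ (RV v)) (F : Polynomial (RV v)) :
    (tl l F).natDegree ≤ F.natDegree := by
  rw [Polynomial.natDegree_le_iff_coeff_eq_zero]
  intro N hN
  rw [tl_coeff, Polynomial.coeff_eq_zero_of_natDegree_lt hN, map_zero]

lemma tl_kill {v : ℕ} (l : Module.Dual ℂ (RV v)) (g : RV v) (h : ∀ f, l (g * f) = 0)
    (F : Polynomial (RV v)) : tl l (Polynomial.C g * F) = 0 := by
  ext i
  rw [tl_coeff, Polynomial.coeff_C_mul, h]; simp

def LL (v : ℕ) : Polynomial (RV v) := ∑ j : Fin v, Polynomial.C (MvPolynomial.X j) * Polynomial.X ^ (j : ℕ)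

lemma LL_eval (v : ℕ) (u : ℂ) : (LL v).eval (MvPolynomial.C u) = ell v u := by
  unfold LL ell
  rw [Polynomial.eval_finsetSum]
  apply Finset.sum_congr rfl
  intro j _
  rw [Polynomial.eval_mul, Polynomial.eval_C, Polynomial.eval_pow, Polynomial.eval_X, map_pow, mul_comm]

lemma LL_natDegree (v : ℕ) : (LL (v+1)).natDegree ≤ v := by
  unfold LL
  apply Polynomial.natDegree_sum_le_of_forall_le
  intro j _
  refine (Polynomial.natDegree_C_mul_X_pow_le _ _).trans ?_
  have := j.2; omega

lemma LL_split (v : ℕ) (t : ℂ) : ∃ M, LL v = Polynomial.C (ell v t) +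
    (Polynomial.X - Polynomial.C (MvPolynomial.C t)) * M := by
  obtain ⟨M, hM⟩ := Polynomial.X_sub_C_dvd_sub_C_eval (a := (MvPolynomial.C t : RV v)) (p := LL v)
  exact ⟨M, by rw [← hM, LL_eval]; ring⟩

lemma dvd_pt {v : ℕ} (l : Module.Dual ℂ (RV v)) (t : ℂ) (a e : ℕ)
    (h : ∀ f, l (ell v t ^ a * f) = 0) (F : Polynomial (RV v)) :
    (Polynomial.X - Polynomial.C t) ^ (e + 1 - a) ∣ tl l (LL v ^ e * F) := by
  obtain ⟨M, hM⟩ := LL_split v t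
  rw [hM, add_pow, Finset.sum_mul, tl_sum]
  apply Finset.dvd_sum
  intro k hk
  have hk' : k ≤ e := by simp at hk; omega
  by_cases hka : a ≤ k
  · have : Polynomial.C (ell v t) ^ k * ((Polynomial.X - Polynomial.C (MvPolynomial.C t)) * M) ^ (e - k) * (e.choose k : Polynomial (RV v)) * F
      = Polynomial.C (ell v t ^ a) * (Polynomial.C (ell v t) ^ (k - a) * ((Polynomial.X - Polynomial.C (MvPolynomial.C t)) * M) ^ (e - k) * (e.choose k : Polynomial (RV v)) * F) := by
      obtain ⟨b, rfl⟩ := Nat.exists_eq_add_of_le hka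
      rw [Nat.add_sub_cancel_left, pow_add, map_pow]; ring
    rw [this, tl_kill _ _ h]
    exact dvd_zero _
  · have : Polynomial.C (ell v t) ^ k * ((Polynomial.X - Polynomial.C (MvPolynomial.C t)) * M) ^ (e - k) * (e.choose k : Polynomial (RV v)) * F
      = (Polynomial.X - Polynomial.C (MvPolynomial.C t)) ^ (e - k) * (Polynomial.C (ell v t) ^ k * M ^ (e - k) * (e.choose k : Polynomial (RV v)) * F) := by
      rw [mul_pow]; ring
    rw [this, tl_X_sub_C_pow]
    exact Dvd.dvd.mul_right (pow_dvd_pow _ (by omega)) _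

lemma sq_id {A : Type*} [CommRing A] (x y : A) (e : ℕ) :
    ∃ z, (e : A) * x ^ (e+1) - (e + 1) * x ^ e * y + y ^ (e+1) = (x - y) ^ 2 * z := by
  induction e with
  | zero => exact ⟨0, by simp⟩
  | succ e ih =>
    obtain ⟨z, hz⟩ := ih
    refine ⟨y * z + (e+1) * x ^ e, ?_⟩
    push_cast
    linear_combination y * hz

lemma tl_eq_zero {v : ℕ} (l : Module.Dual ℂ (RV v)) (e : ℕ)
    (h : ∀ u f, l (ell v u ^ e * f) = 0) (g : RV v) : tl l (LL v ^ e * Polynomial.C g) = 0 := by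
  apply Polynomial.funext
  intro u
  rw [tl_eval, Polynomial.eval_mul, Polynomial.eval_pow, LL_eval, Polynomial.eval_C, h]
  simp

lemma dvd_sq {v : ℕ} (l : Module.Dual ℂ (RV v)) (w : ℂ) (e : ℕ)
    (h : ∀ u f, l (ell v u ^ (e+1) * f) = 0) (g : RV v) :
    (Polynomial.X - Polynomial.C w) ^ 2 ∣ tl l (LL v ^ e * Polynomial.C (ell v w * g)) := by
  obtain ⟨M, hM⟩ := LL_split v w
  obtain ⟨z, hz⟩ := sq_id (LL v) (Polynomial.C (ell v w)) e
  have h1 : (((e+1 : ℕ)) : Polynomial (RV v)) * (LL v ^ e * Polynomial.C (ell v w * g)) =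
      ((e : ℕ) : Polynomial (RV v)) * (LL v ^ (e+1) * Polynomial.C g)
      + Polynomial.C (ell v w ^ (e+1)) * Polynomial.C g
      - (Polynomial.X - Polynomial.C (MvPolynomial.C w)) ^ 2 * (M ^ 2 * z * Polynomial.C g) := by
    have h2 : LL v - Polynomial.C (ell v w) = (Polynomial.X - Polynomial.C (MvPolynomial.C w)) * M := by
      rw [hM]; ring
    rw [h2] at hz
    push_cast
    rw [map_mul, map_pow]
    linear_combination (-Polynomial.C g) * hz
  have h3 := congrArg (tl l) h1
  rw [tl_natmul, tl_sub, tl_add, tl_natmul, tl_eq_zero l (e+1) h, tl_kill _ _ (h w), tl_X_sub_C_pow,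
    mul_zero, zero_add, zero_sub] at h3
  have h4 : tl l (LL v ^ e * Polynomial.C (ell v w * g)) =
      Polynomial.C (((e+1 : ℕ) : ℂ)⁻¹) * (((e+1 : ℕ) : Polynomial ℂ) * tl l (LL v ^ e * Polynomial.C (ell v w * g))) := by
    rw [← mul_assoc, ← Polynomial.C_eq_natCast, ← Polynomial.C_mul, inv_mul_cancel₀, Polynomial.C_1, one_mul]
    exact Nat.cast_ne_zero.2 (by omega)
  rw [h4, h3]
  exact Dvd.dvd.mul_left ((dvd_mul_right _ _).neg_right) _

lemma lin_ker {v : ℕ} (μ : Module.Dual ℂ (RV v)) (f : RV v) (T : Set ℂ) (hT : T.Infinite)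
    (h : ∀ w ∈ T, μ (ell v w * f) = 0) (j : Fin v) : μ (MvPolynomial.X j * f) = 0 := by
  have h0 : (∑ j : Fin v, Polynomial.C (μ (MvPolynomial.X j * f)) * Polynomial.X ^ (j:ℕ)) = 0 := by
    apply Polynomial.eq_zero_of_infinite_isRoot
    apply hT.mono
    intro w hw
    have := h w hw
    unfold ell at this
    rw [Finset.sum_mul, map_sum] at this
    change Polynomial.eval w _ = 0
    rw [Polynomial.eval_finsetSum, ← this]
    apply Finset.sum_congr rfl
    intro i _
    rw [mul_assoc, MvPolynomial.C_mul', map_smul, Polynomial.eval_mul, Polynomial.eval_C, Polynomial.eval_pow,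
      Polynomial.eval_X, smul_eq_mul, mul_comm]
  have := congrArg (fun P => Polynomial.coeff P (j:ℕ)) h0
  simp only [Polynomial.finsetSum_coeff, Polynomial.coeff_C_mul, Polynomial.coeff_X_pow, Polynomial.coeff_zero] at this
  rw [Finset.sum_eq_single j] at this
  · simpa using this
  · intro b _ hb
    rw [if_neg, mul_zero]
    intro hh; exact hb (Fin.ext hh.symm)
  · simp

lemma X_ker {v m : ℕ} {μ : Module.Dual ℂ (RV v)} (hμ : μ ∈ Conc v (m+1))
    (h : ∀ j f, μ (MvPolynomial.X j * f) = 0) : μ = 0 := by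
  apply dual_ext
  intro α
  by_cases hα : α = 0
  · subst hα
    exact hμ _ 0 (MvPolynomial.isHomogeneous_monomial _ (by simp)) (by omega)
  · obtain ⟨j, hj⟩ := Finsupp.ne_iff.1 hα
    have : α = Finsupp.single j 1 + (α - Finsupp.single j 1) := by
      rw [add_tsub_cancel_of_le]
      rw [Finsupp.single_le_iff]
      simp at hj; omega
    rw [this, ← one_mul (1:ℂ), ← MvPolynomial.monomial_mul]
    exact h j _

lemma span_lem {v : ℕ} (m : ℕ) (μ : Module.Dual ℂ (RV v)) (hμ : μ ∈ Conc v m) (A : Finset ℂ)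
    (h : ∀ B : Finset ℂ, B.card = m → Disjoint B A → μ (∏ w ∈ B, ell v w) = 0) : μ = 0 := by
  classical
  induction m generalizing μ A with
  | zero =>
    apply conc_ext hμ
    intro f hf
    have h1 := h ∅ (by simp) (by simp)
    rw [Finset.prod_empty] at h1
    rw [MvPolynomial.totalDegree_eq_zero_iff_eq_C.1 (Nat.le_zero.1 hf.totalDegree_le), ← mul_one (MvPolynomial.C _), MvPolynomial.C_mul', map_smul, h1, smul_zero]
  | succ m ih =>
    have h2 : ∀ w ∈ ((A : Set ℂ)ᶜ), ∀ f, μ (ell v w * f) = 0 := by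
      intro w hw f
      have : mulF μ (ell v w) = 0 := by
        apply ih _ (by simpa using mulF_conc hμ (ell_hom v w) (by omega)) (insert w A)
        intro B hB hd
        rw [Finset.disjoint_insert_right] at hd
        rw [mulF_apply, ← Finset.prod_insert hd.1]
        apply h
        · rw [Finset.card_insert_of_notMem hd.1, hB]
        · rw [Finset.disjoint_insert_left]
          exact ⟨by simpa using hw, hd.2⟩
      rw [← mulF_apply, this]; rfl
    apply X_ker hμ
    intro j f
    exact lin_ker μ f _ (A.finite_toSet.infinite_compl) (fun w hw => h2 w hw f) j

lemma base_locus {v d : ℕ} {S : Finset ℂ} {a : ℂ → ℕ} {l : Module.Dual ℂ (RV (v+1))}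
    (hl : l ∈ Wd (v+1) d S a) (e0 : ℕ)
    (hnum : ∀ e, e0 ≤ e → e ≤ d → ∑ t ∈ S, a t + v * e < S.card * (e+1) + 2 * (d - e)) :
    ∀ e, e0 ≤ e → ∀ u f, l (ell (v+1) u ^ e * f) = 0 := by
  classical
  suffices H : ∀ k e, d + 1 - e = k → e0 ≤ e → ∀ u f, l (ell (v+1) u ^ e * f) = 0 from
    fun e => H _ e rfl
  intro k
  induction k with
  | zero =>
    intro e he _ u f
    exact conc_gt hl.1 (ell_pow_hom _ u e) (by omega) f
  | succ k ih =>
    intro e he he0 u f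
    have hed : e ≤ d := by omega
    have h1 := ih (e+1) (by omega) (by omega)
    have : mulF l (ell (v+1) u ^ e) = 0 := by
      apply span_lem (d - e) _ (mulF_conc hl.1 (ell_pow_hom _ u e) hed) S
      intro B hB hBS
      rw [mulF_apply]
      have hq : tl l (LL (v+1) ^ e * Polynomial.C (∏ w ∈ B, ell (v+1) w)) = 0 := by
        set q := tl l (LL (v+1) ^ e * Polynomial.C (∏ w ∈ B, ell (v+1) w)) with hqdef
        have hdeg : q.natDegree ≤ e * v := by
          refine (tl_natDegree _ _).trans ((Polynomial.natDegree_mul_C_le _ _).trans ?_)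
          exact Polynomial.natDegree_pow_le_of_le e (LL_natDegree v)
        have hdvd : (∏ t ∈ S ∪ B, (Polynomial.X - Polynomial.C t) ^ (if t ∈ S then e + 1 - a t else 2)) ∣ q := by
          apply Finset.prod_dvd_of_coprime
          · intro x _ y _ hxy
            exact (Polynomial.isCoprime_X_sub_C_of_isUnit_sub (sub_ne_zero.2 hxy).isUnit).pow
          · intro t ht
            split_ifs with hts
            · exact dvd_pt l t (a t) e (hl.2 t hts) _
            · have htB : t ∈ B := by
                rcases Finset.mem_union.1 ht with h | h
                · exact absurd h hts
                · exact h
              rw [hqdef, ← Finset.mul_prod_erase B _ htB]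
              exact dvd_sq l t e h1 _
        by_contra hne
        have h2 := Polynomial.natDegree_le_of_dvd hdvd hne
        rw [Polynomial.natDegree_prod_of_monic _ _ (fun i _ => (Polynomial.monic_X_sub_C i).pow _)] at h2
        simp only [Polynomial.natDegree_pow, Polynomial.natDegree_X_sub_C, mul_one] at h2
        rw [Finset.sum_union hBS.symm] at h2
        have h3 : ∑ t ∈ B, (if t ∈ S then e + 1 - a t else 2) = 2 * (d - e) := by
          rw [Finset.sum_congr rfl (g := fun _ => 2)]
          · simp [hB, mul_comm]
          · intro t ht
            rw [if_neg (Finset.disjoint_left.1 hBS ht)]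
        have h4 : S.card * (e+1) ≤ ∑ t ∈ S, (if t ∈ S then e + 1 - a t else 2) + ∑ t ∈ S, a t := by
          rw [← Finset.sum_add_distrib, ← smul_eq_mul]
          apply Finset.card_nsmul_le_sum
          intro t ht
          rw [if_pos ht]; omega
        have h5 := hnum e he0 hed
        rw [h3] at h2
        have h6 : e * v = v * e := mul_comm _ _
        omega
      have h2 := congrArg (Polynomial.eval u) hq
      rw [tl_eval, Polynomial.eval_mul, Polynomial.eval_pow, LL_eval, Polynomial.eval_C] at h2
      simpa using h2
    rw [← mulF_apply, this]; rfl



def phi (v : ℕ) (t : ℂ) : RV v →ₐ[ℂ] RV (v+1) :=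
  MvPolynomial.aeval (fun a : Fin v => ∑ j : Fin (v+1),
    if (a:ℕ) < (j:ℕ) then MvPolynomial.C (t ^ ((j:ℕ) - 1 - (a:ℕ))) * MvPolynomial.X j else 0)

lemma LL_proj (v : ℕ) (t : ℂ) : LL (v+1) = Polynomial.C (ell (v+1) t) +
    (Polynomial.X - Polynomial.C (MvPolynomial.C t)) * (LL v).map (phi v t).toRingHom := by
  have h1 : (LL v).map (phi v t).toRingHom = ∑ j : Fin (v+1), Polynomial.C (MvPolynomial.X j) *
      ∑ a ∈ Finset.range (j:ℕ), Polynomial.X ^ a * (Polynomial.C (MvPolynomial.C t)) ^ ((j:ℕ) - 1 - a) := by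
    have h2 : ∀ j : Fin (v+1), ∑ a ∈ Finset.range (j:ℕ), Polynomial.X ^ a * (Polynomial.C (MvPolynomial.C t : RV (v+1))) ^ ((j:ℕ) - 1 - a)
      = ∑ a : Fin v, if (a:ℕ) < (j:ℕ) then Polynomial.X ^ (a:ℕ) * (Polynomial.C (MvPolynomial.C t)) ^ ((j:ℕ) - 1 - (a:ℕ)) else 0 := by
      intro j
      rw [Fin.sum_univ_eq_sum_range (fun a => if a < (j:ℕ) then Polynomial.X ^ a * (Polynomial.C (MvPolynomial.C t : RV (v+1))) ^ ((j:ℕ) - 1 - a) else 0) v,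
        ← Finset.sum_filter]
      apply Finset.sum_congr _ (fun _ _ => rfl)
      ext a
      have := j.2
      simp; omega
    simp only [h2, Finset.mul_sum]
    rw [Finset.sum_comm]
    unfold LL
    rw [Polynomial.map_sum]
    apply Finset.sum_congr rfl
    intro a _
    rw [Polynomial.map_mul, Polynomial.map_C, Polynomial.map_pow, Polynomial.map_X]
    have h3 : (phi v t).toRingHom (MvPolynomial.X a) = ∑ j : Fin (v+1),
      if (a:ℕ) < (j:ℕ) then MvPolynomial.C (t ^ ((j:ℕ) - 1 - (a:ℕ))) * MvPolynomial.X j else 0 := by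
      change phi v t (MvPolynomial.X a) = _
      unfold phi
      rw [MvPolynomial.aeval_X]
    rw [h3, map_sum, Finset.sum_mul]
    apply Finset.sum_congr rfl
    intro j _
    split_ifs
    · rw [Polynomial.C_mul, map_pow, map_pow]; ring
    · simp
  rw [h1, Finset.mul_sum]
  unfold LL ell
  rw [map_sum, ← Finset.sum_add_distrib]
  apply Finset.sum_congr rfl
  intro j _
  have := geom_sum₂_mul (Polynomial.X : Polynomial (RV (v+1))) (Polynomial.C (MvPolynomial.C t)) (j:ℕ)
  rw [Polynomial.C_mul, map_pow, map_pow]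
  linear_combination -Polynomial.C (MvPolynomial.X j) * this

lemma map_eval_phi (v : ℕ) (t u : ℂ) (P : Polynomial (RV v)) :
    (P.map (phi v t).toRingHom).eval (MvPolynomial.C u) = phi v t (P.eval (MvPolynomial.C u)) := by
  have h : (MvPolynomial.C u : RV (v+1)) = (phi v t).toRingHom (MvPolynomial.C u) := by
    change _ = phi v t (MvPolynomial.C u)
    unfold phi
    rw [MvPolynomial.aeval_C]; rfl
  rw [h, Polynomial.eval_map_apply]
  rfl

lemma ell_proj (v : ℕ) (t u : ℂ) :
    ell (v+1) u = ell (v+1) t + MvPolynomial.C (u - t) * phi v t (ell v u) := by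
  have := congrArg (Polynomial.eval (MvPolynomial.C u)) (LL_proj v t)
  rw [LL_eval, Polynomial.eval_add, Polynomial.eval_mul, map_eval_phi, LL_eval] at this
  rw [this]
  simp

lemma LL_coeff (v : ℕ) (j : Fin v) : (LL v).coeff (j:ℕ) = MvPolynomial.X j := by
  unfold LL
  simp only [Polynomial.finsetSum_coeff, Polynomial.coeff_C_mul, Polynomial.coeff_X_pow]
  rw [Finset.sum_eq_single j]
  · simp
  · intro b _ hb
    rw [if_neg, mul_zero]
    intro hh; exact hb (Fin.ext hh.symm)
  · simp

lemma X_proj (v : ℕ) (t : ℂ) (j : Fin (v+1)) :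
    ∃ g h, (MvPolynomial.X j : RV (v+1)) = phi v t g + ell (v+1) t * h := by
  have h0 := congrArg (fun P => Polynomial.coeff P (j:ℕ)) (LL_proj v t)
  have h1 : (Polynomial.X - Polynomial.C (MvPolynomial.C t)) * (LL v).map (phi v t).toRingHom
    = ((Polynomial.X - Polynomial.C (MvPolynomial.C t)) * (LL v)).map (phi v t).toRingHom := by
    have h : (MvPolynomial.C t : RV (v+1)) = (phi v t).toRingHom (MvPolynomial.C t) := by
      change _ = phi v t (MvPolynomial.C t)
      unfold phi
      rw [MvPolynomial.aeval_C]; rfl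
    rw [Polynomial.map_mul, Polynomial.map_sub, Polynomial.map_X, Polynomial.map_C, h]
  simp only [h1] at h0
  rw [LL_coeff, Polynomial.coeff_add, Polynomial.coeff_map, Polynomial.coeff_C] at h0
  refine ⟨((Polynomial.X - Polynomial.C (MvPolynomial.C t)) * (LL v)).coeff (j:ℕ), if (j:ℕ) = 0 then 1 else 0, ?_⟩
  refine (h0.trans (add_comm _ _)).trans ?_
  congr 1
  split_ifs <;> simp

lemma proj_surj (v : ℕ) (t : ℂ) (f : RV (v+1)) :
    ∃ g h, f = phi v t g + ell (v+1) t * h := by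
  induction f using MvPolynomial.induction_on with
  | C c =>
    refine ⟨MvPolynomial.C c, 0, ?_⟩
    unfold phi
    rw [MvPolynomial.aeval_C]; simp
  | add p q hp hq =>
    obtain ⟨g, h, hp⟩ := hp
    obtain ⟨g', h', hq⟩ := hq
    refine ⟨g + g', h + h', ?_⟩
    rw [hp, hq, map_add]; ring
  | mul_X p j hp =>
    obtain ⟨g, h, hp⟩ := hp
    obtain ⟨g', h', hq⟩ := X_proj v t j
    refine ⟨g * g', h * (phi v t g' + ell (v+1) t * h') + phi v t g * h', ?_⟩
    rw [hp, hq, map_mul]; ring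

lemma phi_hom {v : ℕ} (t : ℂ) {f : RV v} {e : ℕ} (hf : f.IsHomogeneous e) :
    (phi v t f).IsHomogeneous e := by
  unfold phi
  have := hf.aeval (R := ℂ) (fun a : Fin v => ∑ j : Fin (v+1),
    if (a:ℕ) < (j:ℕ) then MvPolynomial.C (t ^ ((j:ℕ) - 1 - (a:ℕ))) * MvPolynomial.X j else 0) (n := 1) (by
      intro a
      apply MvPolynomial.IsHomogeneous.sum
      intro j _
      split_ifs
      · exact MvPolynomial.IsHomogeneous.C_mul (MvPolynomial.isHomogeneous_X _ _) _
      · exact MvPolynomial.isHomogeneous_zero _ _ _)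
  simpa using this

def dropMap (v : ℕ) (i : ℂ) (c : ℕ) : Module.Dual ℂ (RV (v+1)) →ₗ[ℂ] Module.Dual ℂ (RV v) where
  toFun l := (mulF l (ell (v+1) i ^ c)).comp (phi v i).toLinearMap
  map_add' := by intros; rfl
  map_smul' := by intros; rfl

lemma dropMap_apply {v : ℕ} (i : ℂ) (c : ℕ) (l : Module.Dual ℂ (RV (v+1))) (f : RV v) :
    dropMap v i c l f = l (ell (v+1) i ^ c * phi v i f) := rfl

lemma drop_le {v d : ℕ} {S : Finset ℂ} {a : ℂ → ℕ} {i : ℂ} (hi : i ∈ S) {c : ℕ} (hc : a i = c + 1)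
    (W' : Submodule ℂ (Module.Dual ℂ (RV v))) [Module.Finite ℂ W']
    (h : ∀ l ∈ Wd (v+1) d S a, dropMap v i c l ∈ W') :
    hW (v+1) d S a ≤ hW (v+1) d S (Function.update a i c) + (Module.finrank ℂ W' : ℤ) := by
  let f : Wd (v+1) d S a →ₗ[ℂ] W' :=
    ((dropMap v i c).comp (Wd (v+1) d S a).subtype).codRestrict W' (fun x => h x.1 x.2)
  have h1 := f.finrank_range_add_finrank_ker
  have h2 : Module.finrank ℂ (LinearMap.range f) ≤ Module.finrank ℂ W' := Submodule.finrank_le _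
  have h3 : Module.finrank ℂ (LinearMap.ker f) ≤ Module.finrank ℂ (Wd (v+1) d S (Function.update a i c)) := by
    rw [← Submodule.finrank_map_subtype_eq]
    apply Submodule.finrank_mono
    rintro _ ⟨l, hl, rfl⟩
    have hl' : dropMap v i c l.1 = 0 := congrArg Subtype.val (LinearMap.mem_ker.1 hl)
    refine ⟨l.2.1, ?_⟩
    intro t ht g
    by_cases hti : t = i
    · subst hti
      rw [Function.update_self]
      obtain ⟨g', h', rfl⟩ := proj_surj v t g
      have e1 := LinearMap.congr_fun hl' g'
      rw [dropMap_apply] at e1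
      have e2 := l.2.2 t ht h'
      rw [hc] at e2
      have : ell (v+1) t ^ c * ((phi v t) g' + ell (v+1) t * h') =
        ell (v+1) t ^ c * (phi v t) g' + ell (v+1) t ^ (c+1) * h' := by ring
      rw [this, map_add]
      change l.1 _ + l.1 _ = 0
      rw [e1, e2]; simp
    · rw [Function.update_of_ne hti]
      exact l.2.2 t ht g
  unfold hW
  omega

lemma drop_gt {v d : ℕ} {S : Finset ℂ} {a : ℂ → ℕ} {i : ℂ} {c : ℕ} (hcd : d < c) :
    hW v d S a ≤ hW v d S (Function.update a i c) := by
  apply hW_mono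
  intro l hl
  refine ⟨hl.1, fun t ht f => ?_⟩
  by_cases hti : t = i
  · subst hti
    rw [Function.update_self]
    exact conc_gt hl.1 (ell_pow_hom _ _ _) hcd f
  · rw [Function.update_of_ne hti]
    exact hl.2 t ht f

lemma drop_conc {v d : ℕ} {l : Module.Dual ℂ (RV (v+1))} (hl : l ∈ Conc (v+1) d) (i : ℂ) {c : ℕ} (hc : c ≤ d) :
    dropMap v i c l ∈ Conc v (d - c) := by
  intro f e hf he
  rw [dropMap_apply]
  exact hl _ _ ((ell_pow_hom _ _ _).mul (phi_hom i hf)) (by omega)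

lemma drop_other {v d : ℕ} {S : Finset ℂ} {a : ℂ → ℕ} {i : ℂ} (hi : i ∈ S) {c : ℕ} (hc : a i = c + 1)
    {l : Module.Dual ℂ (RV (v+1))} (hl : l ∈ Wd (v+1) d S a) {t : ℂ} (ht : t ∈ S) (hti : t ≠ i) (f : RV v) :
    dropMap v i c l (ell v t ^ a t * f) = 0 := by
  rw [dropMap_apply, map_mul (phi v i), map_pow (phi v i)]
  have h1 := ell_proj v i t
  obtain ⟨z, hz⟩ := sub_dvd_pow_sub_pow (MvPolynomial.C (t - i) * phi v i (ell v t)) (ell (v+1) t) (a t)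
  have h2 : MvPolynomial.C (t - i) * phi v i (ell v t) - ell (v+1) t = - ell (v+1) i := by
    rw [h1]; ring
  rw [h2, mul_pow, ← map_pow] at hz
  have h3 : MvPolynomial.C ((t-i)^(a t)) * (ell (v+1) i ^ c * (phi v i (ell v t) ^ a t * phi v i f)) =
     ell (v+1) t ^ a t * (ell (v+1) i ^ c * phi v i f) + ell (v+1) i ^ (a i) * (- z * phi v i f) := by
    rw [hc]
    linear_combination (ell (v+1) i ^ c * phi v i f) * hz
  have h4 := congrArg l h3
  rw [map_add, hl.2 t ht, hl.2 i hi, MvPolynomial.C_mul', map_smul, smul_eq_mul, add_zero] at h4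
  exact (mul_eq_zero.1 h4).resolve_left (pow_ne_zero _ (sub_ne_zero.2 hti))

lemma drop_tangent {v d : ℕ} {S : Finset ℂ} {a : ℂ → ℕ} {i : ℂ} (hi : i ∈ S) {c κ : ℕ} (hc : a i = c + 1)
    (hcκ : c ≤ κ)
    {l : Module.Dual ℂ (RV (v+1))} (hl : l ∈ Wd (v+1) d S a)
    (hb : ∀ u f, l (ell (v+1) u ^ κ * f) = 0) (f : RV v) :
    dropMap v i c l (ell v i ^ (κ - c) * f) = 0 := by
  rw [dropMap_apply, map_mul (phi v i), map_pow (phi v i)]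
  set g := phi v i f
  set M := (LL v).map (phi v i).toRingHom with hMdef
  have h0 := tl_eq_zero l κ hb g
  rw [LL_proj v i, ← hMdef, add_pow, Finset.sum_mul, tl_sum] at h0
  set D := (Polynomial.X - Polynomial.C (MvPolynomial.C i : RV (v+1))) with hD
  have hterm : ∀ k, Polynomial.C (ell (v+1) i) ^ k * (D * M) ^ (κ - k) * (κ.choose k : Polynomial (RV (v+1))) * Polynomial.C g
     = D ^ (κ - k) * (((κ.choose k : ℕ) : Polynomial (RV (v+1))) * (Polynomial.C (ell (v+1) i ^ k) * (M ^ (κ - k) * Polynomial.C g))) := by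
    intro k
    rw [mul_pow, map_pow]; ring
  simp only [hterm] at h0
  simp only [hD, tl_X_sub_C_pow, tl_natmul] at h0
  rw [← Finset.add_sum_erase _ _ (Finset.mem_range.2 (by omega : c < κ + 1))] at h0
  have hrest : (Polynomial.X - Polynomial.C i) ^ (κ - c) * (Polynomial.X - Polynomial.C i) ∣
    ∑ k ∈ (Finset.range (κ+1)).erase c, (Polynomial.X - Polynomial.C i) ^ (κ - k) *
      ((κ.choose k : Polynomial ℂ) * tl l (Polynomial.C (ell (v+1) i ^ k) * (M ^ (κ - k) * Polynomial.C g))) := by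
    apply Finset.dvd_sum
    intro k hk
    rw [Finset.mem_erase, Finset.mem_range] at hk
    by_cases hkc : k < c
    · rw [← pow_succ]
      exact Dvd.dvd.mul_right (pow_dvd_pow _ (by omega)) _
    · rw [tl_kill l]
      · simp
      · intro f'
        obtain ⟨b, hb⟩ : ∃ b, k = a i + b := ⟨k - a i, by omega⟩
        rw [hb, pow_add, mul_assoc]
        exact hl.2 i hi _
  obtain ⟨Q, hQ⟩ := hrest
  rw [hQ, mul_assoc, ← mul_add] at h0
  have h1 := (mul_eq_zero.1 h0).resolve_left (pow_ne_zero _ (Polynomial.X_sub_C_ne_zero i))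
  have h2 := congrArg (Polynomial.eval i) h1
  rw [Polynomial.eval_add, Polynomial.eval_mul, Polynomial.eval_mul, tl_eval] at h2
  simp only [Polynomial.eval_sub, Polynomial.eval_X, Polynomial.eval_C, sub_self, zero_mul, add_zero, Polynomial.eval_zero] at h2
  rw [Polynomial.eval_natCast] at h2
  have h3 := (mul_eq_zero.1 h2).resolve_left (Nat.cast_ne_zero.2 (Nat.choose_pos hcκ).ne')
  rw [Polynomial.eval_mul, Polynomial.eval_mul, Polynomial.eval_pow, Polynomial.eval_C, Polynomial.eval_C, hMdef, map_eval_phi, LL_eval] at h3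
  exact h3

/-- drop in the `T` case -/
lemma drop_T {v d : ℕ} {S : Finset ℂ} {a : ℂ → ℕ} {i : ℂ} (hi : i ∈ S) {c κ : ℕ} (hc : a i = c + 1)
    (hcκ : c ≤ κ) (hcd : c ≤ d)
    (hb : ∀ l ∈ Wd (v+1) d S a, ∀ u f, l (ell (v+1) u ^ κ * f) = 0) :
    hW (v+1) d S a ≤ hW (v+1) d S (Function.update a i c)
      + hW v (d - c) S (Function.update a i (κ - c)) := by
  apply drop_le hi hc
  intro l hl
  refine ⟨drop_conc hl.1 i hcd, fun t ht f => ?_⟩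
  by_cases hti : t = i
  · subst hti
    rw [Function.update_self]
    exact drop_tangent hi hc hcκ hl (hb l hl) f
  · rw [Function.update_of_ne hti]
    exact drop_other hi hc hl ht hti f

/-- drop in the `S` case -/
lemma drop_S {v d : ℕ} {S : Finset ℂ} {a : ℂ → ℕ} {i : ℂ} (hi : i ∈ S) {c : ℕ} (hc : a i = c + 1)
    (hcd : c ≤ d) :
    hW (v+1) d S a ≤ hW (v+1) d S (Function.update a i c) + hW v (d - c) (S.erase i) a := by
  apply drop_le hi hc
  intro l hl
  refine ⟨drop_conc hl.1 i hcd, fun t ht f => ?_⟩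
  rw [Finset.mem_erase] at ht
  exact drop_other hi hc hl ht.2 ht.1 f



def BS (v d : ℕ) (S : Finset ℂ) (a : ℂ → ℕ) : ℤ :=
  PowerSeries.coeff d (Np S a * Gs 1 ^ v)

lemma Np_erase {S : Finset ℂ} (a : ℂ → ℕ) {i : ℂ} (hi : i ∈ S) :
    Np S a = (1 - PowerSeries.X ^ a i) * Np (S.erase i) a := by
  unfold Np
  rw [Finset.mul_prod_erase S (fun t => (1 : PowerSeries ℤ) - PowerSeries.X ^ a t) hi]

lemma Np_erase_update (S : Finset ℂ) (a : ℂ → ℕ) (i : ℂ) (c : ℕ) :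
    Np (S.erase i) (Function.update a i c) = Np (S.erase i) a := by
  unfold Np
  apply Finset.prod_congr rfl
  intro t ht
  rw [Function.update_of_ne (Finset.ne_of_mem_erase ht)]

lemma Np_update {S : Finset ℂ} (a : ℂ → ℕ) {i : ℂ} (hi : i ∈ S) (c : ℕ) :
    Np S (Function.update a i c) = (1 - PowerSeries.X ^ c) * Np (S.erase i) a := by
  rw [Np_erase _ hi, Function.update_self, Np_erase_update]

lemma Gs_one : Gs 1 * (1 - PowerSeries.X) = 1 := by
  simpa using Gs_mul (c := 1) one_pos

lemma BS_rec {v d : ℕ} {S : Finset ℂ} {a : ℂ → ℕ} {i : ℂ} (hi : i ∈ S) {c : ℕ} (hc : a i = c + 1) :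
    BS (v+1) d S a = BS (v+1) d S (Function.update a i c) +
      (if c ≤ d then BS v (d - c) (S.erase i) a else 0) := by
  unfold BS
  rw [← PowerSeries.coeff_X_pow_mul', ← map_add]
  congr 1
  rw [Np_erase a hi, Np_update a hi, hc]
  linear_combination (PowerSeries.X ^ c * Np (S.erase i) a * Gs 1 ^ v) * Gs_one

lemma BB_rec {v d : ℕ} {S : Finset ℂ} {a : ℂ → ℕ} {i : ℂ} (hi : i ∈ S) {c κ p p' : ℕ} (hc : a i = c + 1)
    (hκ : c < κ) :
    BB (v+1) d S a κ p (p'+1) = BB (v+1) d S (Function.update a i c) κ (p+1) p' +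
      (if c ≤ d then BB v (d - c) S (Function.update a i (κ - c)) κ (p+1) (p'+1) else 0) := by
  unfold BB
  rw [← PowerSeries.coeff_X_pow_mul', ← map_add]
  congr 1
  rw [Np_erase a hi, Np_update a hi, Np_update a hi, hc]
  have h1 := Gs_one
  have h2 := Gs_mul (c := κ) (by omega)
  have h3 := Gs_mul (c := κ + 1) (by omega)
  obtain ⟨b, rfl⟩ := Nat.exists_eq_add_of_lt hκ
  have e1 : c + b + 1 - c = b + 1 := by omega
  rw [e1]
  set N := Np (S.erase i) a
  set x : PowerSeries ℤ := PowerSeries.X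
  set g := Gs 1
  set A := Gs (c + b + 1)
  set A' := Gs (c + b + 1 + 1)
  have key : (1 - x ^ (c+1)) * A' = (1 - x ^ c) * A + x ^ c * (1 - x) * (1 - x ^ (b+1)) * A * A' := by
    linear_combination ((x^(c+1) - 1) * A') * h2 + ((1 - x^c) * A) * h3
  rw [pow_succ g, pow_succ A', pow_succ A]
  linear_combination (N * g ^ v * g * A ^ p * A' ^ p') * key + (x^c * (1-x^(b+1)) * N * g ^ v * A ^ p * A * A' ^ p' * A') * h1

def Pal (D : ℕ) (P : Polynomial ℤ) : Prop := P.natDegree ≤ D ∧ P.reflect D = P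

lemma pal_mul {D E : ℕ} {P Q : Polynomial ℤ} (hP : Pal D P) (hQ : Pal E Q) : Pal (D+E) (P*Q) :=
  ⟨(Polynomial.natDegree_mul_le).trans (add_le_add hP.1 hQ.1), by
    rw [Polynomial.reflect_mul _ _ hP.1 hQ.1, hP.2, hQ.2]⟩

def qn (a : ℕ) : Polynomial ℤ := ∑ i ∈ Finset.range a, Polynomial.X ^ i

lemma pal_qn (a : ℕ) : Pal a (qn (a+1)) := by
  constructor
  · apply Polynomial.natDegree_sum_le_of_forall_le
    intro i hi
    rw [Polynomial.natDegree_X_pow]; simp at hi; omega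
  · ext i
    rw [Polynomial.coeff_reflect]
    unfold qn
    simp only [Polynomial.finsetSum_coeff, Polynomial.coeff_X_pow, Finset.sum_ite_eq, Finset.mem_range]
    by_cases h : i ≤ a
    · rw [Polynomial.revAt_le h, if_pos (by omega), if_pos (by omega)]
    · rw [Polynomial.revAt_eq_self_of_lt (by omega)]

lemma pal_prod (S : Finset ℂ) (a : ℂ → ℕ) (h : ∀ t ∈ S, a t ≠ 0) :
    ∃ D, D + S.card = ∑ t ∈ S, a t ∧ Pal D (∏ t ∈ S, qn (a t)) := by
  classical
  induction S using Finset.induction_on with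
  | empty => exact ⟨0, by simp, by simp, by simp⟩
  | insert x S hx ih =>
    obtain ⟨D, hD, hP⟩ := ih (fun t ht => h t (Finset.mem_insert_of_mem ht))
    obtain ⟨k, hk⟩ := Nat.exists_eq_succ_of_ne_zero (h x (by simp))
    refine ⟨k + D, ?_, ?_⟩
    · rw [Finset.card_insert_of_notMem hx, Finset.sum_insert hx, hk]; omega
    · rw [Finset.prod_insert hx, hk]
      exact pal_mul (pal_qn k) hP

lemma BS_pal {v d : ℕ} {S : Finset ℂ} {a : ℂ → ℕ} (hS : S.card = v + 1) (ha : ∑ t ∈ S, a t = 2 * d + v) :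
    BS v d S a = 0 := by
  by_cases h0 : ∃ t ∈ S, a t = 0
  · obtain ⟨t, ht, h⟩ := h0
    unfold BS
    rw [Np_zero S a t ht h]; simp
  push Not at h0
  obtain ⟨D, hD, hP⟩ := pal_prod S a h0
  have hN : Np S a = (1 - PowerSeries.X) ^ (v+1) * ((∏ t ∈ S, qn (a t) : Polynomial ℤ) : PowerSeries ℤ) := by
    unfold Np
    rw [← hS, ← Polynomial.coeToPowerSeries.ringHom_apply, map_prod, ← Finset.prod_const, ← Finset.prod_mul_distrib]
    apply Finset.prod_congr rfl
    intro t _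
    unfold qn
    rw [map_sum]
    simp only [Polynomial.coeToPowerSeries.ringHom_apply, Polynomial.coe_pow, Polynomial.coe_X]
    have := geom_sum_mul (PowerSeries.X : PowerSeries ℤ) (a t)
    linear_combination this
  unfold BS
  set Q := ∏ t ∈ S, qn (a t)
  have hG : Np S a * Gs 1 ^ v = (Q : PowerSeries ℤ) - PowerSeries.X * (Q : PowerSeries ℤ) := by
    have : (Gs 1 * (1 - PowerSeries.X)) ^ v = 1 := by rw [Gs_one, one_pow]
    rw [mul_pow] at this
    rw [hN, pow_succ]
    linear_combination ((1 - PowerSeries.X) * (Q : PowerSeries ℤ)) * this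
  rw [hG]
  obtain ⟨e, rfl⟩ : ∃ e, d = e + 1 := ⟨d - 1, by omega⟩
  rw [map_sub, PowerSeries.coeff_succ_X_mul, Polynomial.coeff_coe, Polynomial.coeff_coe, sub_eq_zero]
  have h1 := congrArg (fun P => Polynomial.coeff P e) hP.2
  simp only [Polynomial.coeff_reflect] at h1
  rw [← h1, Polynomial.revAt_le (by omega)]
  congr 1; omega

lemma sum_update_lt {S : Finset ℂ} {a : ℂ → ℕ} {i : ℂ} (hi : i ∈ S) (c : ℕ) :
    ∑ t ∈ S, Function.update a i c t + a i = ∑ t ∈ S, a t + c := by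
  rw [Finset.sum_update_of_mem hi, ← Finset.add_sum_erase _ _ hi, Finset.sdiff_singleton_eq_erase]
  omega

lemma S_lem (v : ℕ) : ∀ (d : ℕ) (S : Finset ℂ) (a : ℂ → ℕ), S.card = v + 1 → 2 * d + v ≤ ∑ t ∈ S, a t →
    hW v d S a = BS v d S a := by
  classical
  induction v with
  | zero =>
    intro d S a hS ha
    by_cases h0 : ∃ t ∈ S, a t = 0
    · obtain ⟨t, ht, h⟩ := h0
      rw [hW_zero 0 d S a t ht h]
      unfold BS
      rw [Np_zero S a t ht h]; simp
    push Not at h0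
    obtain ⟨x, rfl⟩ := Finset.card_eq_one.1 (by simpa using hS)
    have : ∀ t ∈ ({x} : Finset ℂ), d < a t := by
      intro t ht
      have h1 := h0 t ht
      rw [Finset.mem_singleton] at ht
      subst ht
      simp at ha; omega
    rw [hW_top 0 d _ a this]
    unfold BS
    rw [coeff_Np_top _ _ _ this]
  | succ v ihv =>
    have upper : ∀ (N d : ℕ) (S : Finset ℂ) (a : ℂ → ℕ), S.card = v + 2 → ∑ t ∈ S, a t = N → 2 * d + (v + 1) ≤ N →
        hW (v+1) d S a ≤ BS (v+1) d S a := by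
      intro N
      induction N with
      | zero => intro d S a _ _ h; omega
      | succ N ih =>
        intro d S a hS ha hN
        by_cases heq : 2 * d + (v+1) = N + 1
        · rw [BS_pal hS (by omega)]
          have : Wd (v+1) d S a = ⊥ := by
            rw [eq_bot_iff]
            intro l hl
            rw [Submodule.mem_bot]
            have := base_locus hl 0 (by
              intro e _ he
              rw [ha, hS]
              obtain ⟨k, rfl⟩ := Nat.exists_eq_add_of_le he
              rw [Nat.add_sub_cancel_left]
              nlinarith) 0 le_rfl
            apply LinearMap.ext
            intro f
            simpa using this 0 f
          unfold hW
          rw [this]; simp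
        · obtain ⟨i, hi⟩ : S.Nonempty := by rw [← Finset.card_pos]; omega
          by_cases h0 : a i = 0
          · rw [hW_zero _ d S a i hi h0]
            unfold BS
            rw [Np_zero S a i hi h0]; simp
          · obtain ⟨c, hc⟩ := Nat.exists_eq_succ_of_ne_zero h0
            have hsum := sum_update_lt (a := a) hi c
            have h1 := ih d S (Function.update a i c) hS (by omega) (by omega)
            rw [BS_rec hi hc]
            by_cases hcd : c ≤ d
            · rw [if_pos hcd]
              have h2 := drop_S (v := v) hi hc hcd
              have h3 := Finset.add_sum_erase S a hi
              rw [ihv (d - c) (S.erase i) a (by rw [Finset.card_erase_of_mem hi]; omega) (by omega)] at h2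
              linarith
            · rw [if_neg hcd]
              have h2 : hW (v+1) d S a ≤ _ := drop_gt (i := i) (c := c) (by omega)
              linarith
    have lower : ∀ (N d : ℕ) (S : Finset ℂ) (a : ℂ → ℕ), S.card = v + 2 → ∑ t ∈ S, (d + 1 - a t) = N →
        2 * d + (v + 1) ≤ ∑ t ∈ S, a t →
        BS (v+1) d S a ≤ hW (v+1) d S a := by
      intro N
      induction N with
      | zero =>
        intro d S a _ h0 _
        rw [Finset.sum_eq_zero_iff] at h0
        have : ∀ t ∈ S, d < a t := fun t ht => by have := h0 t ht; omega
        rw [hW_top _ d _ a this]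
        unfold BS
        rw [coeff_Np_top _ _ _ this]
      | succ N ih =>
        intro d S a hS hN ha
        obtain ⟨i, hi, hid⟩ : ∃ i ∈ S, d + 1 - a i ≠ 0 := by
          by_contra hcon
          push Not at hcon
          rw [Finset.sum_eq_zero hcon] at hN
          omega
        set a' := Function.update a i (a i + 1) with ha'
        have hai : a' i = a i + 1 := by simp [ha']
        have hback : Function.update a' i (a i) = a := by simp [ha']
        have hsum := sum_update_lt (a := a) hi (a i + 1)
        rw [← ha'] at hsum
        have hsum' : ∑ t ∈ S, (d + 1 - a' t) = N := by
          rw [← Finset.add_sum_erase _ _ hi] at hN ⊢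
          have : ∑ t ∈ S.erase i, (d + 1 - a' t) = ∑ t ∈ S.erase i, (d + 1 - a t) := by
            apply Finset.sum_congr rfl
            intro t ht
            rw [ha', Function.update_of_ne (Finset.ne_of_mem_erase ht)]
          rw [this, hai]; omega
        have h1 := ih d S a' hS hsum' (by omega)
        have h2 := drop_S (v := v) (d := d) hi hai (by omega)
        have h3 := BS_rec (v := v) (d := d) hi hai
        have h4 := Finset.add_sum_erase S a' hi
        rw [ihv (d - a i) (S.erase i) a' (by rw [Finset.card_erase_of_mem hi]; omega) (by omega)] at h2
        rw [hback] at h2 h3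
        rw [if_pos (by omega)] at h3
        linarith
    intro d S a hS ha
    exact le_antisymm (upper _ d S a hS rfl ha) (lower _ d S a hS rfl ha)



def TV (v p p' d κ : ℕ) (S : Finset ℂ) (a : ℂ → ℕ) : Prop :=
  S.card = v + 1 + p + p' ∧ ∑ t ∈ S, a t = 2 * d + v + p * κ + p' * (κ + 1) ∧ ∀ t ∈ S, a t ≤ κ

def TT (v : ℕ) : Prop := ∀ p p' d κ S a, TV v p (p'+1) d κ S a → hW v d S a = BB v d S a κ p (p'+1)

lemma TV_base {v p p' d κ : ℕ} {S : Finset ℂ} {a : ℂ → ℕ} (h : TV (v+1) p p' d κ S a)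
    {l : Module.Dual ℂ (RV (v+1))} (hl : l ∈ Wd (v+1) d S a) (u f) : l (ell (v+1) u ^ κ * f) = 0 := by
  obtain ⟨h1, h2, h3⟩ := h
  refine base_locus hl κ ?_ κ le_rfl u f
  intro e he hed
  rw [h1, h2]
  obtain ⟨k, rfl⟩ := Nat.exists_eq_add_of_le he
  obtain ⟨b, rfl⟩ := Nat.exists_eq_add_of_le hed
  rw [Nat.add_sub_cancel_left]
  nlinarith [Nat.zero_le (p * k), Nat.zero_le (p' * k)]

lemma coeff_one_sub (d c : ℕ) (h : d < c) (Q : PowerSeries ℤ) :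
    PowerSeries.coeff d ((1 - PowerSeries.X ^ c) * Q) = PowerSeries.coeff d Q := by
  rw [sub_mul, one_mul, map_sub, PowerSeries.coeff_X_pow_mul', if_neg (by omega), sub_zero]

lemma T_zero : TT 0 := by
  intro p p' d κ S a ⟨h1, h2, h3⟩
  have hbig : ∀ t ∈ S, 2 * d + (p' + 1) ≤ a t := by
    intro t ht
    rw [← Finset.add_sum_erase S a ht] at h2
    have h4 : ∑ x ∈ S.erase t, a x ≤ (S.erase t).card • κ :=
      Finset.sum_le_card_nsmul _ _ _ (fun x hx => h3 x (Finset.mem_of_mem_erase hx))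
    rw [Finset.card_erase_of_mem ht, h1, smul_eq_mul] at h4
    have : (0 + 1 + p + (p'+1) - 1) * κ = p * κ + p' * κ + κ := by
      have : 0 + 1 + p + (p'+1) - 1 = p + p' + 1 := by omega
      rw [this]; ring
    have h5 : (p' + 1) * (κ + 1) = p' * κ + κ + p' + 1 := by ring
    omega
  have hd : ∀ t ∈ S, d < a t := fun t ht => by have := hbig t ht; omega
  obtain ⟨t, ht⟩ : S.Nonempty := by rw [← Finset.card_pos]; omega
  have hκ : d < κ := lt_of_lt_of_le (hd t ht) (h3 t ht)
  rw [hW_top 0 d S a hd]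
  unfold BB
  rw [coeff_Gs_top _ _ _ (by omega), coeff_Gs_top _ _ _ hκ, coeff_Np_top _ _ _ hd]

/-- the key comparison -/
lemma T_step {v : ℕ} (hT : TT v) {p p' d κ : ℕ} {S : Finset ℂ} {a : ℂ → ℕ} (h : TV (v+1) p (p'+1) d κ S a)
    {i : ℂ} (hi : i ∈ S) {c : ℕ} (hc : a i = c + 1) :
    hW (v+1) d S a - BB (v+1) d S a κ p (p'+1) ≤
      hW (v+1) d S (Function.update a i c) - BB (v+1) d S (Function.update a i c) κ (p+1) p' := by
  have hcκ : c < κ := by have := h.2.2 i hi; omega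
  rw [BB_rec hi hc hcκ]
  by_cases hcd : c ≤ d
  · rw [if_pos hcd]
    have h1 := drop_T hi hc hcκ.le hcd (fun l hl u f => TV_base h hl u f)
    rw [hT (p+1) p' (d-c) κ S (Function.update a i (κ - c)) ?_] at h1
    · linarith
    · refine ⟨by rw [h.1]; omega, ?_, ?_⟩
      · have h2 := sum_update_lt (a := a) hi (κ - c)
        have h3 := h.2.1
        have : (p+1) * κ = p * κ + κ := by ring
        omega
      · intro t ht
        by_cases hti : t = i
        · subst hti; rw [Function.update_self]; omega
        · rw [Function.update_of_ne hti]; exact h.2.2 t ht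
  · rw [if_neg hcd]
    have h1 : hW (v+1) d S a ≤ _ := drop_gt (i := i) (c := c) (by omega)
    linarith

lemma BB_shift (v d : ℕ) (S a) (κ r : ℕ) : BB v d S a (κ+1) r 0 = BB v d S a κ 0 r := by
  unfold BB; simp

lemma BB_erase {v d : ℕ} {S : Finset ℂ} {a : ℂ → ℕ} {j : ℂ} (hj : j ∈ S) {κ p p' : ℕ} (hκ : 0 < κ) (hjk : a j = κ) :
    BB v d S a κ (p+1) p' = BB v d (S.erase j) a κ p p' := by
  unfold BB
  congr 1
  rw [Np_erase a hj, hjk, pow_succ]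
  linear_combination (Np (S.erase j) a * Gs 1 ^ v * Gs κ ^ p * Gs (κ+1) ^ p') * Gs_mul hκ

lemma T_term {v : ℕ} {p p' d κ : ℕ} {S : Finset ℂ} {a : ℂ → ℕ}
    (hTr : ∀ d κ S a, TV (v+1) p (p'+1) d κ S a → hW (v+1) d S a = BB (v+1) d S a κ p (p'+1))
    (h : TV (v+1) (p+1) (p'+1) d κ S a) {j : ℂ} (hj : j ∈ S) (hjk : a j = κ) :
    hW (v+1) d S a = BB (v+1) d S a κ (p+1) (p'+1) := by
  by_cases hκ : κ = 0
  · rw [hW_zero _ d S a j hj (by omega)]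
    unfold BB
    rw [Np_zero S a j hj (by omega)]; simp
  have hE : TV (v+1) p (p'+1) d κ (S.erase j) a := by
    refine ⟨by rw [Finset.card_erase_of_mem hj, h.1]; omega, ?_, fun t ht => h.2.2 t (Finset.mem_of_mem_erase ht)⟩
    have h1 := h.2.1
    rw [← Finset.add_sum_erase S a hj] at h1
    have : (p+1) * κ = p * κ + κ := by ring
    omega
  rw [BB_erase hj (by omega) hjk, ← hTr d κ _ a hE]
  apply le_antisymm
  · exact hW_mono (Wd_erase_le _ _ _ _ _)
  · apply hW_mono
    intro l hl
    refine ⟨hl.1, fun t ht f => ?_⟩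
    by_cases htj : t = j
    · subst htj
      rw [hjk]
      exact TV_base hE hl t f
    · exact hl.2 t (Finset.mem_erase.2 ⟨htj, ht⟩) f

lemma update_le {S : Finset ℂ} {a : ℂ → ℕ} {κ : ℕ} (h : ∀ t ∈ S, a t ≤ κ) (i : ℂ) {c : ℕ} (hc : c ≤ κ) :
    ∀ t ∈ S, Function.update a i c t ≤ κ := by
  intro t ht
  by_cases hti : t = i
  · subst hti; rw [Function.update_self]; exact hc
  · rw [Function.update_of_ne hti]; exact h t ht

lemma T_upper {v : ℕ} (hT : TT v) (r : ℕ)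
    (hTr : ∀ p p' d κ S a, p + p' + 1 = r → TV (v+1) p (p'+1) d κ S a → hW (v+1) d S a = BB (v+1) d S a κ p (p'+1)) :
    ∀ (N p p' d κ : ℕ) (S : Finset ℂ) (a : ℂ → ℕ), p + p' = r → ∑ t ∈ S, a t = N → TV (v+1) p (p'+1) d κ S a →
      hW (v+1) d S a ≤ BB (v+1) d S a κ p (p'+1) := by
  intro N
  induction N with
  | zero =>
    intro p p' d κ S a _ h0 h
    have := h.2.1
    omega
  | succ N ih =>
    intro p p' d κ S a hr hN h
    by_cases hterm : 1 ≤ p ∧ ∃ j ∈ S, a j = κ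
    · obtain ⟨hp, j, hj, hjk⟩ := hterm
      obtain ⟨q, rfl⟩ : ∃ q, p = q + 1 := ⟨p - 1, by omega⟩
      exact (T_term (fun d κ S a => hTr q p' d κ S a (by omega)) h hj hjk).le
    obtain ⟨i, hi⟩ : S.Nonempty := by rw [← Finset.card_pos, h.1]; omega
    by_cases h0 : a i = 0
    · rw [hW_zero _ d S a i hi h0]
      unfold BB
      rw [Np_zero S a i hi h0]; simp
    obtain ⟨c, hc⟩ := Nat.exists_eq_succ_of_ne_zero h0
    have hcκ : c < κ := by have := h.2.2 i hi; omega
    have hsum := sum_update_lt (a := a) hi c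
    have hstep := T_step hT h hi hc
    suffices hW (v+1) d S (Function.update a i c) ≤ BB (v+1) d S (Function.update a i c) κ (p+1) p' by linarith
    rcases Nat.eq_zero_or_pos p' with hp' | hp'
    · subst hp'
      obtain ⟨k, rfl⟩ : ∃ k, κ = k + 1 := ⟨κ - 1, by omega⟩
      have hs := h.2.1
      by_cases hall : ∀ t ∈ S, Function.update a i c t ≤ k
      · rw [BB_shift]
        apply ih 0 p d k S _ (by omega) (by omega)
        refine ⟨by rw [h.1]; omega, ?_, hall⟩
        have e1 : (p+1) * (k+1) = p * (k+1) + (k + 1) := by ring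
        omega
      · push Not at hall
        obtain ⟨j, hj, hjk⟩ := hall
        have hji : j ≠ i := by
          rintro rfl
          rw [Function.update_self] at hjk; omega
        have hjk' : a j = k + 1 := by
          rw [Function.update_of_ne hji] at hjk
          have := h.2.2 j hj; omega
        have hp0 : p = 0 := by
          by_contra hp
          exact hterm ⟨by omega, j, hj, hjk'⟩
        subst hp0
        have hjk2 : Function.update a i c j = k + 1 := by rw [Function.update_of_ne hji, hjk']
        rw [BB_erase hj (by omega) hjk2]
        refine (hW_mono (Wd_erase_le _ _ _ _ j)).trans ?_
        rw [S_lem (v+1) d (S.erase j) _ (by rw [Finset.card_erase_of_mem hj, h.1]; omega)]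
        · unfold BS BB; simp
        · rw [← Finset.add_sum_erase S _ hj, hjk2] at hsum
          omega
    · obtain ⟨q, rfl⟩ : ∃ q, p' = q + 1 := ⟨p' - 1, by omega⟩
      apply ih (p+1) q d κ S _ (by omega) (by omega)
      have hs := h.2.1
      refine ⟨by rw [h.1]; omega, ?_, update_le h.2.2 i hcκ.le⟩
      have e1 : (p+1) * κ = p * κ + κ := by ring
      have e2 : (q+1+1) * (κ+1) = (q+1) * (κ+1) + (κ + 1) := by ring
      omega

lemma T_lower_one {v : ℕ} (hT : TT v) :
    ∀ (N d κ : ℕ) (S : Finset ℂ) (a : ℂ → ℕ) (j : ℂ), j ∈ S → d + 1 - a j = N → TV (v+1) 0 1 d κ S a →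
      BB (v+1) d S a κ 0 1 ≤ hW (v+1) d S a := by
  intro N
  induction N with
  | zero =>
    intro d κ S a j hj hN h
    have hjd : d < a j := by omega
    have hκ := h.2.2 j hj
    have hs := h.2.1
    rw [← Finset.add_sum_erase S a hj] at hs
    have h1 : hW (v+1) d (S.erase j) a ≤ hW (v+1) d S a := by
      apply hW_mono
      intro l hl
      refine ⟨hl.1, fun t ht f => ?_⟩
      by_cases htj : t = j
      · subst htj
        exact conc_gt hl.1 (ell_pow_hom _ _ _) hjd f
      · exact hl.2 t (Finset.mem_erase.2 ⟨htj, ht⟩) f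
    rw [S_lem (v+1) d (S.erase j) _ (by rw [Finset.card_erase_of_mem hj, h.1]; omega) (by omega)] at h1
    refine le_trans (le_of_eq ?_) h1
    unfold BB BS
    rw [coeff_Gs_top _ _ _ (by omega), pow_zero, mul_one, Np_erase a hj, mul_assoc, coeff_one_sub _ _ hjd]
  | succ N ih =>
    intro d κ S a j hj hN h
    set a' := Function.update a j (a j + 1) with ha'
    have hai : a' j = a j + 1 := by simp [ha']
    have hback : Function.update a' j (a j) = a := by simp [ha']
    have hsum := sum_update_lt (a := a) hj (a j + 1)
    rw [← ha'] at hsum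
    have hs := h.2.1
    have hκ := h.2.2 j hj
    have h' : TV (v+1) 0 1 d (κ+1) S a' :=
      ⟨h.1, by omega, update_le (fun t ht => (h.2.2 t ht).trans (by omega)) j (by omega)⟩
    have h1 := ih d (κ+1) S a' j hj (by omega) h'
    have h2 := T_step hT h' hj hai
    rw [hback, zero_add, BB_shift] at h2
    linarith

lemma T_lower {v : ℕ} (hT : TT v) (r : ℕ) (hr1 : 1 ≤ r)
    (hTr : ∀ p p' d κ S a, p + p' + 1 = r → TV (v+1) p (p'+1) d κ S a → hW (v+1) d S a = BB (v+1) d S a κ p (p'+1)) :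
    ∀ (N p p' d κ : ℕ) (S : Finset ℂ) (a : ℂ → ℕ) (j : ℂ), j ∈ S → p + p' = r →
      2 * (κ - a j) + (if p = 0 then 1 else 0) = N → TV (v+1) p (p'+1) d κ S a →
      BB (v+1) d S a κ p (p'+1) ≤ hW (v+1) d S a := by
  intro N
  induction N using Nat.strong_induction_on with
  | _ N ih =>
    intro p p' d κ S a j hj hr hN h
    have hκ := h.2.2 j hj
    have hs := h.2.1
    set a' := Function.update a j (a j + 1) with ha'
    have hai : a' j = a j + 1 := by simp [ha']
    have hback : Function.update a' j (a j) = a := by simp [ha']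
    have hsum := sum_update_lt (a := a) hj (a j + 1)
    rw [← ha'] at hsum
    rcases Nat.eq_zero_or_pos p with hp | hp
    · subst hp
      obtain rfl : p' = r := by omega
      have h' : TV (v+1) p' (0+1) d (κ+1) S a' := by
        refine ⟨by rw [h.1]; omega, ?_, update_le (fun t ht => (h.2.2 t ht).trans (by omega)) j (by omega)⟩
        have e1 : (p'+1) * (κ+1) = p' * (κ+1) + (κ + 1) := by ring
        omega
      have h1 := ih _ (by rw [hai, if_neg (by omega : p' ≠ 0)]; rw [if_pos rfl] at hN; omega) p' 0 d (κ+1) S a' j hj rfl rfl h'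
      have h2 := T_step hT h' hj hai
      rw [hback, BB_shift] at h2
      linarith
    · obtain ⟨q, rfl⟩ : ∃ q, p = q + 1 := ⟨p - 1, by omega⟩
      by_cases hjk : a j = κ
      · exact (T_term (fun d κ S a => hTr q p' d κ S a (by omega)) h hj hjk).ge
      · have h' : TV (v+1) q (p'+1+1) d κ S a' := by
          refine ⟨by rw [h.1]; omega, ?_, update_le h.2.2 j (by omega)⟩
          have e1 : (p'+1+1) * (κ+1) = (p'+1) * (κ+1) + (κ + 1) := by ring
          have e2 : (q+1) * κ = q * κ + κ := by ring
          omega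
        have hlt : 2 * (κ - a' j) + (if q = 0 then 1 else 0) < N := by
          rw [hai]
          rw [if_neg (by omega)] at hN
          split_ifs <;> omega
        have h1 := ih _ hlt q (p'+1) d κ S a' j hj (by omega) rfl h'
        have h2 := T_step hT h' hj hai
        rw [hback] at h2
        linarith

theorem T_main (v : ℕ) : TT v := by
  induction v with
  | zero => exact T_zero
  | succ v hT =>
    have : ∀ r p p' d κ S a, p + p' = r → TV (v+1) p (p'+1) d κ S a →
        hW (v+1) d S a = BB (v+1) d S a κ p (p'+1) := by
      intro r
      induction r with
      | zero =>
        intro p p' d κ S a hr h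
        obtain ⟨j, hj⟩ : S.Nonempty := by rw [← Finset.card_pos, h.1]; omega
        apply le_antisymm
        · exact T_upper hT 0 (by intros; omega) _ p p' d κ S a hr rfl h
        · obtain rfl : p = 0 := by omega
          obtain rfl : p' = 0 := by omega
          exact T_lower_one hT _ d κ S a j hj rfl h
      | succ r ih =>
        intro p p' d κ S a hr h
        obtain ⟨j, hj⟩ : S.Nonempty := by rw [← Finset.card_pos, h.1]; omega
        have ih' : ∀ p p' d κ S a, p + p' + 1 = r + 1 → TV (v+1) p (p'+1) d κ S a →
            hW (v+1) d S a = BB (v+1) d S a κ p (p'+1) :=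
          fun p p' d κ S a hh => ih p p' d κ S a (by omega)
        apply le_antisymm
        · exact T_upper hT (r+1) ih' _ p p' d κ S a hr rfl h
        · exact T_lower hT (r+1) (by omega) ih' _ p p' d κ S a j hj hr rfl h
    intro p p' d κ S a h
    exact this _ p p' d κ S a rfl h



def annI {v : ℕ} (l : Module.Dual ℂ (RV v)) : Ideal (RV v) where
  carrier := {g | ∀ f, l (g * f) = 0}
  zero_mem' := by intro f; simp
  add_mem' := by
    intro a b ha hb f
    rw [add_mul, map_add, ha, hb, add_zero]
  smul_mem' := by
    intro c a ha f
    rw [smul_eq_mul, mul_comm c a, mul_assoc]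
    exact ha _

lemma pig {R : Type*} [CommRing R] (J : Ideal R) (Z : Finset ℂ) (y : ℂ → R) (n : ℂ → ℕ)
    (h : ∀ z ∈ Z, y z ^ (n z + 1) ∈ J) (k : ℕ) (hk : ∑ z ∈ Z, n z < k) : (∑ z ∈ Z, y z) ^ k ∈ J := by
  classical
  induction Z using Finset.induction_on generalizing k with
  | empty =>
    rw [Finset.sum_empty, zero_pow (by omega)]
    exact J.zero_mem
  | insert z Z hz ih =>
    rw [Finset.sum_insert hz] at hk ⊢
    have h1 := ih (fun z hz => h z (Finset.mem_insert_of_mem hz)) (∑ z ∈ Z, n z + 1) (by omega)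
    exact Ideal.add_pow_mem_of_pow_mem_of_le J (h z (by simp)) h1 (by omega)

lemma deriv_lem {v : ℕ} (l : Module.Dual ℂ (RV v)) (x w : RV v) (G : Polynomial (RV v)) (t : ℂ) (m : ℕ)
    (T : Set ℂ) (hT : T.Infinite)
    (h : ∀ s ∈ T, l ((x + MvPolynomial.C (s - t) * G.eval (MvPolynomial.C s)) ^ (m+1) * w) = 0) :
    l (x ^ m * (G.eval (MvPolynomial.C t) * w)) = 0 := by
  set D := (Polynomial.X - Polynomial.C (MvPolynomial.C t : RV v)) with hD
  have h0 : tl l ((Polynomial.C x + D * G) ^ (m+1) * Polynomial.C w) = 0 := by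
    apply Polynomial.eq_zero_of_infinite_isRoot
    apply hT.mono
    intro s hs
    have := h s hs
    change Polynomial.eval s _ = 0
    rw [tl_eval, ← this]
    simp [hD]
  obtain ⟨z, hz⟩ := Polynomial.powAddExpansion (Polynomial.C x) (D * G) (m+1)
  have hexp : (Polynomial.C x + D * G) ^ (m+1) * Polynomial.C w =
      Polynomial.C (x ^ (m+1)) * Polynomial.C w
      + (D ^ 1 * ((((m+1 : ℕ)) : Polynomial (RV v)) * (Polynomial.C (x ^ m) * (G * Polynomial.C w)))
        + D ^ 2 * (z * G ^ 2 * Polynomial.C w)) := by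
    rw [hz, map_pow, map_pow, Nat.add_sub_cancel]; ring
  have hx : l (x ^ (m+1) * w) = 0 := by
    have := congrArg (Polynomial.eval t) h0
    rw [tl_eval] at this
    simpa [hD] using this
  rw [hexp, tl_add, tl_add, hD, tl_X_sub_C_pow, tl_X_sub_C_pow, tl_natmul] at h0
  have h1 : tl l (Polynomial.C (x ^ (m+1)) * Polynomial.C w) = 0 := by
    rw [← Polynomial.C_mul]
    ext i
    rw [tl_coeff, Polynomial.coeff_C]
    split_ifs <;> simp [hx]
  rw [h1, zero_add, pow_one, pow_two, mul_assoc (_ - _), ← mul_add] at h0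
  have h2 := (mul_eq_zero.1 h0).resolve_left (Polynomial.X_sub_C_ne_zero t)
  have h3 := congrArg (Polynomial.eval t) h2
  rw [Polynomial.eval_add, Polynomial.eval_mul, Polynomial.eval_mul, tl_eval] at h3
  simp only [Polynomial.eval_sub, Polynomial.eval_X, Polynomial.eval_C, sub_self, zero_mul, add_zero,
    Polynomial.eval_zero, Polynomial.eval_mul, Polynomial.eval_natCast] at h3
  exact (mul_eq_zero.1 h3).resolve_left (Nat.cast_ne_zero.2 (by omega))

lemma span_two {v : ℕ} (μ : Module.Dual ℂ (RV (v+1))) (I U : Finset ℂ) (hIU : Disjoint I U)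
    (hcard : v + 1 ≤ I.card + 2 * U.card) (w : RV (v+1))
    (M : ℂ → Polynomial (RV (v+1)))
    (hM : ∀ t, LL (v+1) = Polynomial.C (ell (v+1) t) + (Polynomial.X - Polynomial.C (MvPolynomial.C t)) * M t)
    (h1 : ∀ z ∈ I, μ (ell (v+1) z * w) = 0) (h2 : ∀ z ∈ U, μ (ell (v+1) z * w) = 0)
    (h3 : ∀ z ∈ U, μ ((M z).eval (MvPolynomial.C z) * w) = 0) (j : Fin (v+1)) :
    μ (MvPolynomial.X j * w) = 0 := by
  classical
  have hkill : ∀ g : RV (v+1), μ (g * w) = 0 → tl μ (Polynomial.C g * Polynomial.C w) = 0 := by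
    intro g hg
    rw [← Polynomial.C_mul]
    ext i
    rw [tl_coeff, Polynomial.coeff_C]
    split_ifs <;> simp [hg]
  have hq : tl μ (LL (v+1) * Polynomial.C w) = 0 := by
    set q := tl μ (LL (v+1) * Polynomial.C w) with hqdef
    have hdeg : q.natDegree ≤ v := by
      refine (tl_natDegree _ _).trans ((Polynomial.natDegree_mul_C_le _ _).trans (LL_natDegree v))
    have hdvd : (∏ t ∈ I ∪ U, (Polynomial.X - Polynomial.C t) ^ (if t ∈ I then 1 else 2)) ∣ q := by
      apply Finset.prod_dvd_of_coprime
      · intro x _ y _ hxy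
        exact (Polynomial.isCoprime_X_sub_C_of_isUnit_sub (sub_ne_zero.2 hxy).isUnit).pow
      · intro t ht
        split_ifs with hts
        · rw [hqdef, hM t, add_mul, tl_add, hkill _ (h1 t hts), zero_add, mul_assoc, tl_X_sub_C, pow_one]
          exact dvd_mul_right _ _
        · have htU : t ∈ U := by
            rcases Finset.mem_union.1 ht with h | h
            · exact absurd h hts
            · exact h
          rw [hqdef, hM t, add_mul, tl_add, hkill _ (h2 t htU), zero_add, mul_assoc, tl_X_sub_C, pow_two]
          apply mul_dvd_mul_left
          rw [Polynomial.dvd_iff_isRoot]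
          change Polynomial.eval _ _ = 0
          rw [tl_eval, Polynomial.eval_mul, Polynomial.eval_C, h3 t htU]
    by_contra hne
    have h2 := Polynomial.natDegree_le_of_dvd hdvd hne
    rw [Polynomial.natDegree_prod_of_monic _ _ (fun i _ => (Polynomial.monic_X_sub_C i).pow _)] at h2
    simp only [Polynomial.natDegree_pow, Polynomial.natDegree_X_sub_C, mul_one] at h2
    rw [Finset.sum_union hIU] at h2
    have e1 : ∑ t ∈ I, (if t ∈ I then 1 else 2) = I.card := by
      rw [Finset.sum_congr rfl (g := fun _ => 1)]
      · simp
      · intro t ht; rw [if_pos ht]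
    have e2 : ∑ t ∈ U, (if t ∈ I then 1 else 2) = 2 * U.card := by
      rw [Finset.sum_congr rfl (g := fun _ => 2)]
      · simp [mul_comm]
      · intro t ht; rw [if_neg (Finset.disjoint_right.1 hIU ht)]
    omega
  have := congrArg (fun P => Polynomial.coeff P (j:ℕ)) hq
  simp only [tl_coeff, Polynomial.coeff_mul_C, LL_coeff, Polynomial.coeff_zero] at this
  exact this

lemma trunc {v d : ℕ} {l : Module.Dual ℂ (RV (v+1))} (hl : l ∈ Conc (v+1) d) (hne : l ≠ 0)
    (I : Finset ℂ) (t : ℕ) (n : ℂ → ℕ) (K : ℕ)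
    (hI : ∀ z ∈ I, ∀ f, l (ell (v+1) z ^ (n z + 1) * f) = 0)
    (hK : ∀ u f, l (ell (v+1) u ^ (K + 1) * f) = 0)
    (hcard : v + 1 ≤ I.card + 2 * t) : d ≤ ∑ z ∈ I, n z + t * K := by
  classical
  by_contra hlt
  push Not at hlt
  choose M hM using fun t => LL_split (v+1) t
  have H : ∀ k m, m + k = d → ∀ (U : Finset ℂ) (c : ℂ → ℂ), U.card = t → Disjoint I U → (∀ z ∈ U, c z ≠ 0) →
      ∀ w, l ((∑ z ∈ I, MvPolynomial.C (c z) * ell (v+1) z + ∑ z ∈ U, MvPolynomial.C (c z) * ell (v+1) z) ^ m * w) = 0 := by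
    intro k
    induction k with
    | zero =>
      intro m hm U c hU hIU _ w
      obtain rfl : m = d := by omega
      rw [← Finset.sum_union hIU]
      have := pig (annI l) (I ∪ U) (fun z => MvPolynomial.C (c z) * ell (v+1) z) (fun z => if z ∈ I then n z else K)
        (by
          intro z hz
          rw [mul_pow]
          apply Ideal.mul_mem_left
          split_ifs with h
          · exact hI z h
          · exact hK z) m (by
          rw [Finset.sum_union hIU]
          have e1 : ∑ z ∈ I, (if z ∈ I then n z else K) = ∑ z ∈ I, n z :=
            Finset.sum_congr rfl (fun z hz => if_pos hz)
          have e2 : ∑ z ∈ U, (if z ∈ I then n z else K) = t * K := by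
            rw [Finset.sum_congr rfl (fun z hz => if_neg (Finset.disjoint_right.1 hIU hz))]
            simp [hU]
          omega)
      exact this w
    | succ k ih =>
      intro m hm U c hU hIU hc w
      have ih' := ih (m+1) (by omega)
      set x := ∑ z ∈ I, MvPolynomial.C (c z) * ell (v+1) z + ∑ z ∈ U, MvPolynomial.C (c z) * ell (v+1) z with hx
      have hxh : x.IsHomogeneous 1 := by
        apply MvPolynomial.IsHomogeneous.add <;>
        · apply MvPolynomial.IsHomogeneous.sum
          intro j _
          exact MvPolynomial.IsHomogeneous.C_mul (ell_hom _ _) _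
      have hxm : (x ^ m).IsHomogeneous m := by simpa using hxh.pow m
      suffices mulF l (x ^ m) = 0 by rw [← mulF_apply, this]; rfl
      have hconc := mulF_conc hl hxm (by omega)
      have e : d - m = k + 1 := by omega
      rw [e] at hconc
      apply X_ker hconc
      intro j w
      have hupd : ∀ z s, (z ∈ I ∨ z ∈ U) → x + MvPolynomial.C (s - 0) * ell (v+1) z =
          ∑ z' ∈ I, MvPolynomial.C (Function.update c z (c z + s) z') * ell (v+1) z'
          + ∑ z' ∈ U, MvPolynomial.C (Function.update c z (c z + s) z') * ell (v+1) z' := by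
        intro z s hz
        rw [← Finset.sum_union hIU, hx, ← Finset.sum_union hIU]
        have hzm : z ∈ I ∪ U := Finset.mem_union.2 hz
        rw [← Finset.add_sum_erase _ _ hzm, ← Finset.add_sum_erase _ _ hzm, Function.update_self]
        have : ∑ z' ∈ (I ∪ U).erase z, MvPolynomial.C (Function.update c z (c z + s) z') * ell (v+1) z'
          = ∑ z' ∈ (I ∪ U).erase z, MvPolynomial.C (c z') * ell (v+1) z' := by
          apply Finset.sum_congr rfl
          intro z' hz'
          rw [Function.update_of_ne (Finset.ne_of_mem_erase hz')]
        rw [this, map_add, sub_zero]; ring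
      apply span_two (mulF l (x ^ m)) I U hIU (by omega) w M hM
      · intro z hz
        have := deriv_lem l x w (Polynomial.C (ell (v+1) z)) 0 m Set.univ Set.infinite_univ (by
          intro s _
          rw [Polynomial.eval_C, hupd z s (Or.inl hz)]
          apply ih' U _ hU hIU
          intro z' hz'
          rw [Function.update_of_ne (by rintro rfl; exact Finset.disjoint_left.1 hIU hz hz')]
          exact hc z' hz')
        simpa using this
      · intro z hz
        have := deriv_lem l x w (Polynomial.C (ell (v+1) z)) 0 m ({-c z}ᶜ : Set ℂ) (Set.finite_singleton _).infinite_compl (by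
          intro s hs
          rw [Polynomial.eval_C, hupd z s (Or.inr hz)]
          apply ih' U _ hU hIU
          intro z' hz'
          by_cases h : z' = z
          · subst h
            rw [Function.update_self]
            intro h0
            apply hs
            rw [Set.mem_singleton_iff]
            linear_combination h0
          · rw [Function.update_of_ne h]; exact hc z' hz')
        simpa using this
      · intro z hz
        have hzI : z ∉ I := Finset.disjoint_right.1 hIU hz
        have := deriv_lem l x w (Polynomial.C (MvPolynomial.C (c z)) * M z) z m (((I ∪ U : Finset ℂ) : Set ℂ)ᶜ)
          (Finset.finite_toSet _).infinite_compl (by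
          intro s hs
          have hsI : s ∉ I := fun h => hs (by simp [h])
          have hsU : s ∉ U := fun h => hs (by simp [h])
          have hsz : s ≠ z := by rintro rfl; exact hsU hz
          have hev := congrArg (Polynomial.eval (MvPolynomial.C s)) (hM z)
          rw [LL_eval] at hev
          simp only [Polynomial.eval_add, Polynomial.eval_mul, Polynomial.eval_sub, Polynomial.eval_X, Polynomial.eval_C] at hev
          have hnew : x + MvPolynomial.C (s - z) * (Polynomial.C (MvPolynomial.C (c z)) * M z).eval (MvPolynomial.C s) =
            ∑ z' ∈ I, MvPolynomial.C (Function.update c s (c z) z') * ell (v+1) z'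
            + ∑ z' ∈ insert s (U.erase z), MvPolynomial.C (Function.update c s (c z) z') * ell (v+1) z' := by
            rw [Finset.sum_insert (by simp [hsU]), Function.update_self, hev, hx, ← Finset.add_sum_erase _ _ hz]
            have e1 : ∑ z' ∈ I, MvPolynomial.C (Function.update c s (c z) z') * ell (v+1) z' =
              ∑ z' ∈ I, MvPolynomial.C (c z') * ell (v+1) z' := by
              apply Finset.sum_congr rfl
              intro z' hz'
              rw [Function.update_of_ne (by rintro rfl; exact hsI hz')]
            have e2 : ∑ z' ∈ U.erase z, MvPolynomial.C (Function.update c s (c z) z') * ell (v+1) z' =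
              ∑ z' ∈ U.erase z, MvPolynomial.C (c z') * ell (v+1) z' := by
              apply Finset.sum_congr rfl
              intro z' hz'
              rw [Function.update_of_ne (by rintro rfl; exact hsU (Finset.mem_of_mem_erase hz'))]
            rw [e1, e2, Polynomial.eval_mul, Polynomial.eval_C, map_sub]
            ring
          rw [hnew]
          apply ih'
          · rw [Finset.card_insert_of_notMem (by simp [hsU]), Finset.card_erase_of_mem hz]
            have : 0 < U.card := Finset.card_pos.2 ⟨z, hz⟩
            omega
          · rw [Finset.disjoint_insert_right]
            exact ⟨hsI, hIU.mono_right (Finset.erase_subset _ _)⟩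
          · intro z' hz'
            rcases Finset.mem_insert.1 hz' with hz2 | hz2
            · rw [hz2, Function.update_self]; exact hc z hz
            · rw [Function.update_of_ne (fun h : z' = s => hsU (h ▸ Finset.mem_of_mem_erase hz2))]
              exact hc z' (Finset.mem_of_mem_erase hz2))
        rw [Polynomial.eval_mul, Polynomial.eval_C, mul_assoc, mul_left_comm, MvPolynomial.C_mul', map_smul, smul_eq_mul] at this
        exact (mul_eq_zero.1 this).resolve_left (hc z hz)
  obtain ⟨U, hU, hUc⟩ := (I.finite_toSet.infinite_compl).exists_subset_card_eq t
  apply hne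
  apply LinearMap.ext
  intro w
  have := H d 0 (by omega) U (fun _ => 1) hUc (by
    rw [Finset.disjoint_right]
    intro z hz hzI
    exact hU hz hzI) (fun _ _ => one_ne_zero) w
  simpa using this



lemma Cb_nat (a k : ℕ) : Cb a k = a.choose k := by
  unfold Cb
  split_ifs with h
  · simp
  · rw [Nat.choose_eq_zero_of_lt (by omega)]; simp

lemma Cb_pascal (a : ℤ) (k : ℕ) : Cb (a+1) (k+1) = Cb a k + Cb a (k+1) := by
  by_cases ha : 0 ≤ a
  · lift a to ℕ using ha
    have h1 := Cb_nat (a+1) (k+1)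
    have h2 := Cb_nat a k
    have h3 := Cb_nat a (k+1)
    push_cast at h1 h2 h3
    rw [h1, h2, h3, Nat.choose_succ_succ]
    push_cast; ring
  · unfold Cb
    rw [if_neg (by omega), if_neg (by omega), if_neg (by omega)]; simp

lemma Cb_mc (q j : ℕ) : Cb ((q : ℤ) - 1 + (j+1)) (j+1) = (q.multichoose (j+1) : ℤ) := by
  have : (q : ℤ) - 1 + (j+1) = ((q + j : ℕ) : ℤ) := by push_cast; ring
  have h2 : (j : ℤ) + 1 = ((j+1 : ℕ) : ℤ) := by push_cast; ring
  rw [this, h2, Cb_nat, Nat.multichoose_eq]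
  congr 2

/-- evaluation of a polynomial in the shift operator -/
def shf (n a : ℤ) : Polynomial ℤ →ₗ[ℤ] ℤ :=
  Polynomial.lsum fun j => LinearMap.mulRight ℤ (Cb (a + j) n)

lemma shf_mono (n a : ℤ) (j : ℕ) (c : ℤ) : shf n a (Polynomial.monomial j c) = c * Cb (a+j) n := by
  simp [shf, Polynomial.lsum_apply]

lemma shf_nat (n a : ℤ) (k : ℕ) (p : Polynomial ℤ) : shf n a ((k : Polynomial ℤ) * p) = k * shf n a p := by
  rw [← nsmul_eq_mul, map_nsmul, nsmul_eq_mul]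

lemma shf_step (n : ℕ) (a : ℤ) (p : Polynomial ℤ) :
    shf (n+1) a ((Polynomial.X - 1) * p) = shf n a p := by
  induction p using Polynomial.induction_on' with
  | add p q hp hq => rw [mul_add, map_add, map_add, hp, hq]
  | monomial j c =>
    rw [sub_mul, one_mul, Polynomial.X_mul_monomial, map_sub, shf_mono, shf_mono, shf_mono]
    have := Cb_pascal (a+j) n
    push_cast
    rw [← add_assoc, this]; ring

lemma shf_steps (n : ℕ) (i : ℕ) (a : ℤ) (p : Polynomial ℤ) :
    shf (n+i : ℕ) a ((Polynomial.X - 1)^i * p) = shf n a p := by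
  induction i generalizing p with
  | zero => simp
  | succ i ih =>
    have : ((n + (i+1) : ℕ) : ℤ) = ((n+i : ℕ) : ℤ) + 1 := by push_cast; ring
    rw [this, pow_succ', mul_assoc, shf_step, ih]

/-- geometric series -/
def geo {R : Type} [CommRing R] (c : R) : PowerSeries R := PowerSeries.mk fun k => c ^ k

lemma geo_mul {R : Type} [CommRing R] (c : R) : geo c * (1 - PowerSeries.C c * PowerSeries.X) = 1 := by
  ext k
  cases k with
  | zero => simp [geo]
  | succ k =>
    rw [mul_sub, mul_one, map_sub, ← mul_assoc, PowerSeries.coeff_succ_mul_X, mul_comm (geo c),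
      PowerSeries.coeff_C_mul]
    simp [geo, PowerSeries.coeff_one, pow_succ']

lemma geo_coeff {R : Type} [CommRing R] (c : R) (k j : ℕ) :
    PowerSeries.coeff j (geo c ^ k) = (k.multichoose j : R) * c ^ j := by
  induction k generalizing j with
  | zero => cases j <;> simp [PowerSeries.coeff_one]
  | succ k ih =>
    have h : geo c ^ (k+1) * (1 - PowerSeries.C c * PowerSeries.X) = geo c ^ k := by
      rw [pow_succ, mul_assoc, geo_mul, mul_one]
    induction j with
    | zero =>
      have := congrArg (PowerSeries.coeff 0) h
      rw [ih] at this
      simpa using this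
    | succ j ihj =>
      have := congrArg (PowerSeries.coeff (j+1)) h
      rw [ih, mul_sub, mul_one, map_sub, ← mul_assoc, PowerSeries.coeff_succ_mul_X,
        mul_comm _ (PowerSeries.C c), PowerSeries.coeff_C_mul, ihj] at this
      rw [Nat.multichoose_succ_succ]
      push_cast
      rw [add_mul, ← this]; ring

def PP (ε q t : ℕ) : Polynomial ℤ :=
  PowerSeries.coeff t (geo (Polynomial.X : Polynomial ℤ) ^ (q - ε) * geo (1 : Polynomial ℤ) ^ (ε+1))

lemma PP_id (ε q t : ℕ) (h : ε ≤ q) :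
    ∑ i ∈ range (t+1), (ε.choose i : Polynomial ℤ) * ((Polynomial.X - 1)^i * PP ε (q+i) (t-i)) =
    ∑ i ∈ range (t+1), (q.multichoose i : Polynomial ℤ) * Polynomial.X ^ i := by
  set E : Polynomial ℤ := Polynomial.X
  have key : ∑ i ∈ range (ε+1), PowerSeries.C (ε.choose i : Polynomial ℤ) *
      (PowerSeries.C ((E-1)^i) * (PowerSeries.X ^ i * (geo E ^ (q+i-ε) * geo (1:Polynomial ℤ) ^ (ε+1)))) =
      geo E ^ q * geo (1 : Polynomial ℤ) := by
    have h1 : (PowerSeries.C (E-1) * PowerSeries.X * geo E + 1) = geo E * (1 - PowerSeries.C 1 * PowerSeries.X) := by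
      have := geo_mul E
      simp only [map_sub, map_one] 
      linear_combination (-1 : PowerSeries (Polynomial ℤ)) * this
    have h2 : geo E ^ q * geo (1 : Polynomial ℤ) = (PowerSeries.C (E-1) * PowerSeries.X * geo E + 1)^ε * geo E ^ (q-ε) * geo (1 : Polynomial ℤ)^(ε+1) := by
      have h3 : geo (1 : Polynomial ℤ)^(ε+1) * (1 - PowerSeries.C 1 * PowerSeries.X)^ε = geo (1 : Polynomial ℤ) := by
        rw [pow_succ, mul_right_comm, ← mul_pow, geo_mul, one_pow, one_mul]
      obtain ⟨r, rfl⟩ := Nat.exists_eq_add_of_le h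
      rw [h1, mul_pow, Nat.add_sub_cancel_left, pow_add]
      linear_combination (-(geo E ^ ε * geo E ^ r)) * h3
    rw [h2, add_pow, Finset.sum_mul, Finset.sum_mul]
    apply Finset.sum_congr rfl
    intro i _
    have : q + i - ε = (q - ε) + i := by omega
    rw [this, pow_add, map_pow, map_natCast]
    ring
  have hc := congrArg (PowerSeries.coeff t) key
  rw [map_sum] at hc
  have hr : PowerSeries.coeff t (geo E ^ q * geo (1 : Polynomial ℤ)) = 
    ∑ i ∈ range (t+1), (q.multichoose i : Polynomial ℤ) * E ^ i := by
    rw [PowerSeries.coeff_mul, Finset.Nat.sum_antidiagonal_eq_sum_range_succ_mk]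
    apply Finset.sum_congr rfl
    intro i _
    rw [geo_coeff]
    simp [geo]
  rw [← hr, ← hc]
  set f : ℕ → Polynomial ℤ := fun i => PowerSeries.coeff t (PowerSeries.C (ε.choose i : Polynomial ℤ) *
      (PowerSeries.C ((E-1)^i) * (PowerSeries.X ^ i * (geo E ^ (q+i-ε) * geo (1:Polynomial ℤ) ^ (ε+1)))))
  have hf : ∀ i, f i = if i ≤ t then (ε.choose i : Polynomial ℤ) * ((E - 1)^i * PP ε (q+i) (t-i)) else 0 := by
    intro i
    simp only [f]
    rw [PowerSeries.coeff_C_mul, PowerSeries.coeff_C_mul, PowerSeries.coeff_X_pow_mul']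
    split_ifs
    · rfl
    · simp
  have e1 : ∑ i ∈ range (t+1), (ε.choose i : Polynomial ℤ) * ((E - 1)^i * PP ε (q+i) (t-i)) = ∑ i ∈ range (t+ε+1), f i := by
    rw [← Finset.sum_subset (s₁ := range (t+1)) (s₂ := range (t+ε+1)) (f := f) (by intro x; simp; omega)]
    · apply Finset.sum_congr rfl
      intro i hi
      rw [hf, if_pos (by simp at hi; omega)]
    · intro i _ hi
      rw [hf, if_neg (by simp at hi; omega)]
  have e2 : ∑ i ∈ range (ε+1), f i = ∑ i ∈ range (t+ε+1), f i := by
    apply Finset.sum_subset (by intro x; simp; omega)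
    intro i _ hi
    rw [hf, Nat.choose_eq_zero_of_lt (by simp at hi; omega)]
    simp
  rw [e1, ← e2]

lemma Fb_closed (ε s : ℕ) : ∀ (t n q : ℕ) (a : ℤ), t ≤ n → s = n + 3 + q → ε ≤ q →
    Fb t a s ε n = shf n a (PP ε q t) := by
  intro t
  induction t using Nat.strong_induction_on with
  | _ t ih =>
  intro n q a htn hs hε
  cases t with
  | zero =>
    have : PP ε q 0 = Polynomial.monomial 0 1 := by
      simp [PP, geo]
    rw [this, shf_mono, Fb]; simp
  | succ t =>
    rw [Fb, if_neg (by omega)]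
    have hid := PP_id ε q (t+1) hε
    rw [Finset.sum_range_succ', Finset.sum_range_succ' (fun i => (q.multichoose i : Polynomial ℤ) * Polynomial.X ^ i)] at hid
    have hid2 := congrArg (shf n a) hid
    rw [map_add, map_add, map_sum, map_sum] at hid2
    have t1 : ∀ j ∈ range (t+1), Cb (ε : ℤ) (j+1) * Fb (t - j) a s ε (n - (j+1)) =
      shf n a ((ε.choose (j+1) : Polynomial ℤ) * ((Polynomial.X - 1)^(j+1) * PP ε (q+(j+1)) (t+1-(j+1)))) := by
      intro j hj
      have hj' := Finset.mem_range.1 hj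
      obtain ⟨k, rfl⟩ := Nat.exists_eq_add_of_le (show j + 1 ≤ n by omega)
      have : (((j + 1 + k : ℕ) : ℤ) - (j+1)) = (k : ℤ) := by push_cast; ring
      rw [this, ih (t-j) (by omega) k (q+(j+1)) a (by omega) (by omega) (by omega)]
      have h2 : (j : ℤ) + 1 = ((j+1 : ℕ) : ℤ) := by push_cast; ring
      rw [h2, Cb_nat, shf_nat, add_comm (j+1) k, shf_steps]
      congr 3
      omega
    have t2 : ∀ j ∈ range (t+1), Cb ((s : ℤ) - n - 4 + (j+1)) (j+1) * Cb (a + (j+1)) n = 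
       shf n a ((q.multichoose (j+1) : Polynomial ℤ) * Polynomial.X ^ (j+1)) := by
      intro j _
      have : (s : ℤ) - n - 4 = q - 1 := by rw [hs]; push_cast; ring
      rw [this, Cb_mc, shf_nat, ← Polynomial.monomial_one_right_eq_X_pow, shf_mono]
      push_cast; ring
    rw [Finset.sum_congr rfl t1, Finset.sum_congr rfl t2]
    have t3 : shf n a ((q.multichoose 0 : Polynomial ℤ) * Polynomial.X ^ 0) = Cb a n := by
      rw [Nat.multichoose_zero_right, Nat.cast_one, one_mul, ← Polynomial.monomial_one_right_eq_X_pow, shf_mono]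
      simp
    rw [t3] at hid2
    simp only [Nat.choose_zero_right, Nat.cast_one, one_mul, pow_zero, add_zero, tsub_zero] at hid2
    linarith

lemma Fb_sum (ε s t n q : ℕ) (a : ℤ) (htn : t ≤ n) (hs : s = n + 3 + q) (hε : ε ≤ q) :
    Fb t a s ε n = ∑ x ∈ antidiagonal t,
      ((q-ε).multichoose x.1 : ℤ) * ((ε+1).multichoose x.2 : ℤ) * Cb (a + x.1) n := by
  rw [Fb_closed ε s t n q a htn hs hε, PP, PowerSeries.coeff_mul, map_sum]
  apply Finset.sum_congr rfl
  intro x _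
  rw [geo_coeff, geo_coeff, one_pow, mul_one]
  have : ((q-ε).multichoose x.1 : Polynomial ℤ) * Polynomial.X ^ x.1 * ((ε+1).multichoose x.2 : Polynomial ℤ)
    = ((q-ε).multichoose x.1 * (ε+1).multichoose x.2) • (Polynomial.monomial x.1 (1:ℤ)) := by
    rw [nsmul_eq_mul, Polynomial.monomial_one_right_eq_X_pow]; push_cast; ring
  rw [this, map_nsmul, shf_mono, nsmul_eq_mul]
  push_cast; ring


lemma Gs_pow_coeff (c : ℕ) (hc : 0 < c) (p N : ℕ) :
    PowerSeries.coeff N (Gs c ^ p) = if c ∣ N then (p.multichoose (N / c) : ℤ) else 0 := by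
  induction p generalizing N with
  | zero =>
    rw [pow_zero, PowerSeries.coeff_one]
    by_cases hN : N = 0
    · simp [hN]
    · rw [if_neg hN]
      split_ifs with h
      · obtain ⟨k, rfl⟩ := h
        rw [Nat.mul_div_cancel_left _ hc]
        cases k with
        | zero => simp at hN
        | succ k => simp
      · rfl
  | succ p ih =>
    have h : Gs c ^ (p+1) * (1 - PowerSeries.X ^ c) = Gs c ^ p := by
      rw [pow_succ, mul_assoc, Gs_mul hc, mul_one]
    induction N using Nat.strong_induction_on with
    | _ N ihN =>
    have h2 := congrArg (PowerSeries.coeff N) h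
    rw [ih, mul_sub, mul_one, map_sub, PowerSeries.coeff_mul_X_pow'] at h2
    by_cases hcN : c ≤ N
    · rw [if_pos hcN, ihN (N - c) (by omega)] at h2
      obtain ⟨M, rfl⟩ := Nat.exists_eq_add_of_le hcN
      have e1 : c + M - c = M := by omega
      have e2 : (c ∣ c + M) ↔ c ∣ M := by simp
      rw [e1] at h2
      simp only [e2] at h2 ⊢
      split_ifs with hd
      · rw [if_pos hd, if_pos hd] at h2
        have e3 : (c + M) / c = M / c + 1 := by
          rw [add_comm, Nat.add_div_right _ hc]
        rw [e3] at h2 ⊢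
        rw [Nat.multichoose_succ_succ]
        push_cast
        linarith
      · rw [if_neg hd, if_neg hd] at h2
        linarith
    · rw [if_neg hcN, sub_zero] at h2
      rw [h2, Nat.div_eq_of_lt (by omega)]
      simp

lemma Gs_pow_expand (c : ℕ) (hc : 0 < c) (p d N : ℕ) (hN : d < N) :
    ∃ M, Gs c ^ p = ∑ i ∈ range N, PowerSeries.C (p.multichoose i : ℤ) * PowerSeries.X ^ (c * i)
      + PowerSeries.X ^ (d+1) * M := by
  have : PowerSeries.X ^ (d+1) ∣ Gs c ^ p - ∑ i ∈ range N, PowerSeries.C (p.multichoose i : ℤ) * PowerSeries.X ^ (c * i) := by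
    rw [PowerSeries.X_pow_dvd_iff]
    intro m hm
    rw [map_sub, map_sum, Gs_pow_coeff c hc, sub_eq_zero]
    simp only [PowerSeries.coeff_C_mul, PowerSeries.coeff_X_pow]
    split_ifs with h
    · obtain ⟨k, rfl⟩ := h
      have hk : k ≤ c * k := Nat.le_mul_of_pos_left k hc
      rw [Nat.mul_div_cancel_left _ hc, Finset.sum_eq_single k]
      · simp
      · intro b _ hb
        rw [if_neg, mul_zero]
        intro h
        exact hb (Nat.eq_of_mul_eq_mul_left hc h).symm
      · intro h; simp at h; omega
    · symm
      apply Finset.sum_eq_zero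
      intro i _
      rw [if_neg, mul_zero]
      rintro rfl
      exact h (dvd_mul_right _ _)
  obtain ⟨M, hM⟩ := this
  exact ⟨M, by rw [← hM]; ring⟩

lemma Gs1_coeff (n d e : ℕ) : PowerSeries.coeff d (Gs 1 ^ (n+1) * PowerSeries.X ^ e) = Cb ((n:ℤ) + d - e) n := by
  rw [PowerSeries.coeff_mul_X_pow']
  split_ifs with h
  · rw [Gs_pow_coeff 1 one_pos]
    have : (n:ℤ) + d - e = ((n + (d - e) : ℕ) : ℤ) := by omega
    rw [this, Cb_nat]
    simp only [isUnit_one, IsUnit.dvd, if_true, Nat.div_one]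
    rw [Nat.multichoose_eq]
    have : n + 1 + (d - e) - 1 = n + (d - e) := by omega
    rw [this, Nat.choose_symm_add]
  · unfold Cb
    rw [if_neg (by omega)]

lemma prod_expand (s : ℕ) (b : Fin s → ℕ) :
    ∏ i, (1 - (PowerSeries.X : PowerSeries ℤ) ^ b i) =
      ∑ I : Finset (Fin s), PowerSeries.C ((-1 : ℤ)^I.card) * PowerSeries.X ^ (∑ i ∈ I, b i) := by
  have h : ∀ i, (1 - (PowerSeries.X : PowerSeries ℤ) ^ b i) = 1 + (-PowerSeries.X ^ b i) := fun i => sub_eq_add_neg _ _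
  simp only [h]
  rw [Finset.prod_one_add, Finset.powerset_univ]
  apply Finset.sum_congr rfl
  intro I _
  rw [Finset.prod_neg, Finset.prod_pow_eq_pow_sum, map_pow, map_neg, map_one]

lemma BB_expand (s n d N κ p p' : ℕ) (b : Fin s → ℕ) (hκ : 0 < κ) (hN : d < N) :
    PowerSeries.coeff d ((∏ i, (1 - (PowerSeries.X : PowerSeries ℤ) ^ b i)) * Gs 1 ^ (n+1) * Gs κ ^ p * Gs (κ+1) ^ p') =
    ∑ I : Finset (Fin s), (-1 : ℤ)^I.card * ∑ i ∈ range N, ∑ j ∈ range N,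
      (p.multichoose i : ℤ) * (p'.multichoose j : ℤ) * Cb ((n:ℤ) + d - ((∑ i ∈ I, b i + κ * i + (κ+1)*j : ℕ) : ℤ)) n := by
  obtain ⟨M, hM⟩ := Gs_pow_expand κ hκ p d N hN
  obtain ⟨M', hM'⟩ := Gs_pow_expand (κ+1) (by omega) p' d N hN
  set A := ∑ i ∈ range N, PowerSeries.C (p.multichoose i : ℤ) * PowerSeries.X ^ (κ * i)
  set B := ∑ i ∈ range N, PowerSeries.C (p'.multichoose i : ℤ) * PowerSeries.X ^ ((κ+1) * i)
  set Q := (∏ i, (1 - (PowerSeries.X : PowerSeries ℤ) ^ b i))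
  have h1 : Q * Gs 1 ^ (n+1) * Gs κ ^ p * Gs (κ+1) ^ p' =
    Q * Gs 1 ^ (n+1) * A * B + PowerSeries.X ^ (d+1) * (Q * Gs 1 ^ (n+1) * (A * M' + M * Gs (κ+1) ^ p')) := by
    rw [hM, hM']; ring
  rw [h1, map_add, PowerSeries.coeff_X_pow_mul', if_neg (by omega), add_zero]
  simp only [Q, A, B]
  rw [prod_expand, mul_assoc, Finset.sum_mul_sum, Finset.sum_mul, Finset.sum_mul, map_sum]
  apply Finset.sum_congr rfl
  intro I _
  rw [Finset.mul_sum, map_sum, Finset.mul_sum]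
  apply Finset.sum_congr rfl
  intro i _
  rw [Finset.mul_sum, map_sum, Finset.mul_sum]
  apply Finset.sum_congr rfl
  intro j _
  have : PowerSeries.C ((-1 : ℤ)^I.card) * PowerSeries.X ^ (∑ i ∈ I, b i) * Gs 1 ^ (n+1) *
     (PowerSeries.C (p.multichoose i : ℤ) * PowerSeries.X ^ (κ * i) * (PowerSeries.C (p'.multichoose j : ℤ) * PowerSeries.X ^ ((κ+1) * j)))
     = PowerSeries.C ((-1 : ℤ)^I.card * ((p.multichoose i : ℤ) * (p'.multichoose j : ℤ))) * (Gs 1 ^ (n+1) * PowerSeries.X ^ (∑ i ∈ I, b i + κ * i + (κ+1)*j)) := by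
    simp only [map_mul, pow_add]; ring
  rw [this, PowerSeries.coeff_C_mul, Gs1_coeff]
  ring

lemma diag_sum (f : ℕ → ℕ → ℤ) (N : ℕ) (h : ∀ i j, N ≤ i + j → f i j = 0) :
    ∑ i ∈ range N, ∑ j ∈ range N, f i j = ∑ t ∈ range N, ∑ x ∈ antidiagonal t, f x.1 x.2 := by
  have h1 : ∀ t ∈ range N, ∑ x ∈ antidiagonal t, f x.1 x.2 = ∑ k ∈ range (t+1), f k (t-k) := by
    intro t _
    rw [Finset.Nat.sum_antidiagonal_eq_sum_range_succ_mk]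
  rw [Finset.sum_congr rfl h1, Finset.sum_range_diag_flip]
  apply Finset.sum_congr rfl
  intro i _
  symm
  apply Finset.sum_subset
  · intro x; simp; omega
  · intro x _ hx
    apply h
    simp at hx; omega

/-- the combinatorial identity -/
lemma comb (s n d κ ε q : ℕ) (b : Fin s → ℕ) (hκ : 0 < κ) (hs : s = n + 3 + q) (hε : ε ≤ q)
    (htr : ∀ (I : Finset (Fin s)) (t : ℕ), n + 1 ≤ I.card + 2 * t → d < ∑ i ∈ I, b i + t * κ) :
    PowerSeries.coeff d ((∏ i, (1 - (PowerSeries.X : PowerSeries ℤ) ^ b i)) * Gs 1 ^ (n+1) * Gs κ ^ (q-ε) * Gs (κ+1) ^ (ε+1)) =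
    ∑ t ∈ (Finset.range (n+1)).filter (fun t => 2 * t ≤ n),
        ∑ I ∈ Finset.univ.filter (fun I : Finset (Fin s) => I.card + 2 * t ≤ n),
          (-1 : ℤ) ^ I.card * Fb t ((n : ℤ) + d - (∑ i ∈ I, b i : ℕ) - t * (κ+1)) s ε n := by
  rw [BB_expand s n d (d+n+1) κ _ _ b hκ (by omega)]
  have hsw : ∀ t ∈ (Finset.range (n+1)).filter (fun t => 2 * t ≤ n),
      ∑ I ∈ Finset.univ.filter (fun I : Finset (Fin s) => I.card + 2 * t ≤ n),
          (-1 : ℤ) ^ I.card * Fb t ((n : ℤ) + d - (∑ i ∈ I, b i : ℕ) - t * (κ+1)) s ε n =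
      ∑ I : Finset (Fin s), if I.card + 2 * t ≤ n then
          (-1 : ℤ) ^ I.card * Fb t ((n : ℤ) + d - (∑ i ∈ I, b i : ℕ) - t * (κ+1)) s ε n else 0 := by
    intro t _
    rw [Finset.sum_filter]
  rw [Finset.sum_congr rfl hsw, Finset.sum_comm]
  apply Finset.sum_congr rfl
  intro I _
  have hz : ∀ i j, n + 1 ≤ I.card + 2 * (i + j) → Cb ((n:ℤ) + d - ((∑ i ∈ I, b i + κ * i + (κ+1)*j : ℕ) : ℤ)) n = 0 := by
    intro i j hij
    have := htr I (i+j) hij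
    have h2 : ∑ i ∈ I, b i + κ * i + (κ+1)*j = ∑ i ∈ I, b i + (i+j) * κ + j := by ring
    unfold Cb
    rw [if_neg]
    rw [h2]; omega
  rw [diag_sum _ _ (by
    intro i j hij
    rw [hz i j (by omega), mul_zero]), Finset.mul_sum]
  symm
  have : (Finset.range (n+1)).filter (fun t => 2 * t ≤ n) ⊆ range (d+n+1) := by
    intro x; simp; omega
  rw [Finset.sum_subset_zero_on_sdiff this]
  · intro t ht
    simp only [Finset.mem_sdiff, Finset.mem_filter, Finset.mem_range] at ht
    have : ∀ x ∈ antidiagonal t, ((q-ε).multichoose x.1 : ℤ) * ((ε+1).multichoose x.2 : ℤ) * Cb ((n:ℤ) + d - ((∑ i ∈ I, b i + κ * x.1 + (κ+1)*x.2 : ℕ) : ℤ)) n = 0 := by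
      intro x hx
      replace hx := HasAntidiagonal.mem_antidiagonal.1 hx
      rw [hz x.1 x.2 (by omega), mul_zero]
    rw [Finset.sum_eq_zero this, mul_zero]
  · intro t ht
    simp only [Finset.mem_filter, Finset.mem_range] at ht
    split_ifs with hI
    · congr 1
      rw [Fb_sum ε s t n q _ (by omega) hs hε]
      apply Finset.sum_congr rfl
      intro x hx
      replace hx := HasAntidiagonal.mem_antidiagonal.1 hx
      congr 2
      rw [← hx]
      push_cast; ring
    · rw [Finset.sum_eq_zero, mul_zero]
      intro x hx
      replace hx := HasAntidiagonal.mem_antidiagonal.1 hx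
      rw [hz x.1 x.2 (by omega), mul_zero]


def af {v : ℕ} (α : Fin v →₀ ℕ) : ℂ := ∏ j, ((α j).factorial : ℂ)

lemma af_ne {v : ℕ} (α : Fin v →₀ ℕ) : af α ≠ 0 :=
  Finset.prod_ne_zero_iff.2 fun _ _ => Nat.cast_ne_zero.2 (Nat.factorial_ne_zero _)

lemma af_succ {v : ℕ} (α : Fin v →₀ ℕ) (j : Fin v) :
    af (α + Finsupp.single j 1) = (α j + 1) * af α := by
  classical
  unfold af
  rw [← Finset.mul_prod_erase univ _ (Finset.mem_univ j), ← Finset.mul_prod_erase univ (fun j => ((α j).factorial : ℂ)) (Finset.mem_univ j)]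
  have : ∏ i ∈ univ.erase j, (((α + Finsupp.single j 1 : Fin v →₀ ℕ) i).factorial : ℂ) = ∏ i ∈ univ.erase j, ((α i).factorial : ℂ) := by
    apply Finset.prod_congr rfl
    intro i hi
    have : i ≠ j := Finset.ne_of_mem_erase hi
    simp [Finsupp.single_apply, this.symm]
  rw [this]
  simp [Nat.factorial_succ]
  ring

/-- the apolar pairing -/
def Pr (v : ℕ) : RV v →ₗ[ℂ] (RV v →ₗ[ℂ] ℂ) :=
  (MvPolynomial.basisMonomials (Fin v) ℂ).constr ℂ (fun α => af α • MvPolynomial.lcoeff ℂ α)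

lemma Pr_mono {v : ℕ} (α : Fin v →₀ ℕ) (P : RV v) :
    Pr v (MvPolynomial.monomial α 1) P = af α * P.coeff α := by
  have := (MvPolynomial.basisMonomials (Fin v) ℂ).constr_basis ℂ (fun α => af α • MvPolynomial.lcoeff ℂ α) α
  rw [MvPolynomial.coe_basisMonomials] at this
  unfold Pr
  rw [this]
  simp

lemma Pr_ext {v : ℕ} {l l' : Module.Dual ℂ (RV v)} 
    (h : ∀ m, l (MvPolynomial.monomial m 1) = l' (MvPolynomial.monomial m 1)) : l = l' := by
  rw [← sub_eq_zero]
  apply dual_ext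
  intro m
  rw [LinearMap.sub_apply, h, sub_self]

lemma Pr_X {v : ℕ} (j : Fin v) (f P : RV v) :
    Pr v (MvPolynomial.X j * f) P = Pr v f (MvPolynomial.pderiv j P) := by
  have : ((Pr v).flip P).comp (LinearMap.mulLeft ℂ (MvPolynomial.X j)) = (Pr v).flip (MvPolynomial.pderiv j P) := by
    apply Pr_ext
    intro α
    rw [LinearMap.comp_apply, LinearMap.mulLeft_apply, LinearMap.flip_apply, LinearMap.flip_apply]
    rw [Pr_mono, MvPolynomial.X, MvPolynomial.monomial_mul, one_mul, add_comm, Pr_mono, af_succ, MvPolynomial.coeff_pderiv]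
    ring
  have := LinearMap.congr_fun this f
  simpa using this

lemma derivAlong_cons {n : ℕ} (j : Fin (n+1)) (D : List (Fin (n+1))) (P) :
    derivAlong (j :: D) P = MvPolynomial.pderiv j (derivAlong D P) := rfl

lemma Pr_list {n : ℕ} (D : List (Fin (n+1))) (f P : RV (n+1)) :
    Pr (n+1) ((D.map MvPolynomial.X).prod * f) P = Pr (n+1) f (derivAlong D P) := by
  induction D generalizing f with
  | nil => simp [derivAlong]
  | cons j D ih =>
    rw [List.map_cons, List.prod_cons, derivAlong_cons, mul_comm (MvPolynomial.X j), mul_assoc, ih, Pr_X]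

lemma derivAlong_hom {n d : ℕ} {P : RV (n+1)} (hP : P.IsHomogeneous d) (D : List (Fin (n+1))) :
    (derivAlong D P).IsHomogeneous (d - D.length) := by
  induction D with
  | nil => simpa [derivAlong] using hP
  | cons j D ih =>
    rw [derivAlong_cons]
    have := ih.pderiv (i := j)
    rw [List.length_cons, ← Nat.sub_sub]
    exact this

lemma Pr_ell (n : ℕ) (u : ℂ) (e : ℕ) : ∀ Q : RV (n+1), Q.IsHomogeneous e →
    Pr (n+1) (ell (n+1) u ^ e) Q = (e.factorial : ℂ) * MvPolynomial.aeval (rncPoint n u) Q := by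
  induction e with
  | zero =>
    intro Q hQ
    have h1 : (1 : RV (n+1)) = MvPolynomial.monomial 0 1 := by simp
    rw [pow_zero, h1, Pr_mono]
    rw [← MvPolynomial.totalDegree_zero_iff_isHomogeneous, MvPolynomial.totalDegree_eq_zero_iff_eq_C] at hQ
    rw [hQ]
    simp [af]
  | succ e ih =>
    intro Q hQ
    have h2 := congrArg (MvPolynomial.aeval (rncPoint n u)) hQ.sum_X_mul_pderiv
    rw [map_sum, map_nsmul] at h2
    rw [pow_succ', ell, Finset.sum_mul, map_sum, LinearMap.sum_apply]
    have : ∀ j : Fin (n+1), Pr (n+1) (MvPolynomial.C (u ^ (j:ℕ)) * MvPolynomial.X j * ell (n+1) u ^ e) Q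
       = (e.factorial : ℂ) * MvPolynomial.aeval (rncPoint n u) (MvPolynomial.X j * MvPolynomial.pderiv j Q) := by
      intro j
      rw [mul_assoc, MvPolynomial.C_mul', map_smul, LinearMap.smul_apply, Pr_X, ih _ (by simpa using hQ.pderiv (i := j)), map_mul, MvPolynomial.aeval_X, rncPoint, smul_eq_mul]
      ring
    have h3 : ∑ j : Fin (n+1), Pr (n+1) (MvPolynomial.C (u ^ (j:ℕ)) * MvPolynomial.X j * ell (n+1) u ^ e) Q = ((e+1).factorial : ℂ) * MvPolynomial.aeval (rncPoint n u) Q := by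
      rw [Finset.sum_congr rfl (fun j _ => this j), ← Finset.mul_sum, h2, nsmul_eq_mul, Nat.factorial_succ]
      push_cast; ring
    exact h3

lemma mono_list {n : ℕ} (α : Fin (n+1) →₀ ℕ) : ∃ D : List (Fin (n+1)), D.length = α.degree ∧
    (MvPolynomial.monomial α (1:ℂ)) = (D.map MvPolynomial.X).prod := by
  induction α using Finsupp.induction_linear with
  | zero => exact ⟨[], by simp, by simp⟩
  | add f g hf hg =>
    obtain ⟨D, h1, h2⟩ := hf
    obtain ⟨D', h1', h2'⟩ := hg
    refine ⟨D ++ D', by simp [h1, h1'], ?_⟩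
    rw [List.map_append, List.prod_append, ← h2, ← h2', MvPolynomial.monomial_mul, one_mul]
  | single j k =>
    refine ⟨List.replicate k j, by simp, ?_⟩
    rw [List.map_replicate, List.prod_replicate, MvPolynomial.X_pow_eq_monomial]

lemma Pr_conc {v d : ℕ} {P : RV v} (hP : P.IsHomogeneous d) : (Pr v).flip P ∈ Conc v d := by
  intro f e hf he
  rw [LinearMap.flip_apply, f.as_sum, map_sum, LinearMap.sum_apply]
  apply Finset.sum_eq_zero
  intro α hα
  have h1 : MvPolynomial.monomial α (f.coeff α) = f.coeff α • MvPolynomial.monomial α (1:ℂ) := by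
    rw [MvPolynomial.smul_monomial]; simp
  have hd : α.degree = e := by
    by_contra hne
    exact (MvPolynomial.mem_support_iff.1 hα) (hf.coeff_eq_zero hne)
  rw [h1, map_smul, LinearMap.smul_apply, Pr_mono, hP.coeff_eq_zero (by omega)]
  simp

lemma Pr_inj (v : ℕ) : Function.Injective (Pr v).flip := by
  rw [← LinearMap.ker_eq_bot, LinearMap.ker_eq_bot']
  intro P hP
  ext α
  have := LinearMap.congr_fun hP (MvPolynomial.monomial α 1)
  rw [LinearMap.flip_apply, Pr_mono] at this
  simpa [af_ne] using this

lemma vanish_iff {n d m : ℕ} {P : RV (n+1)} (hP : P.IsHomogeneous d) (hm : m ≤ d) (u : ℂ) :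
    (∀ D : List (Fin (n+1)), D.length < m → MvPolynomial.aeval (rncPoint n u) (derivAlong D P) = 0) ↔
    ∀ f, Pr (n+1) (ell (n+1) u ^ (d+1-m) * f) P = 0 := by
  constructor
  · intro h f
    have : mulF ((Pr (n+1)).flip P) (ell (n+1) u ^ (d+1-m)) = 0 := by
      apply dual_ext
      intro α
      rw [mulF_apply]
      obtain ⟨D, hD, hD'⟩ := mono_list α
      by_cases hdeg : d + 1 - m + α.degree = d
      · rw [LinearMap.flip_apply, hD', mul_comm, Pr_list]
        have h1 := derivAlong_hom hP D
        have : d - D.length = d + 1 - m := by omega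
        rw [this] at h1
        rw [Pr_ell n u _ _ h1, h D (by omega), mul_zero]
      · exact Pr_conc hP _ _ ((ell_pow_hom (n+1) u _).mul (MvPolynomial.isHomogeneous_monomial _ rfl)) hdeg
    exact LinearMap.congr_fun this f
  · intro h D hD
    have h1 := Pr_ell n u _ _ (derivAlong_hom hP D)
    rw [← Pr_list] at h1
    have : ell (n+1) u ^ (d - D.length) = ell (n+1) u ^ (d+1-m) * ell (n+1) u ^ (d - D.length - (d+1-m)) := by
      rw [← pow_add]; congr 1; omega
    rw [this, mul_left_comm, h] at h1
    have := (mul_eq_zero.1 h1.symm).resolve_left (Nat.cast_ne_zero.2 (Nat.factorial_ne_zero _))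
    exact this

lemma mem_linSys {n d s : ℕ} {m : Fin s → ℕ} {tp : Fin s → ℂ} {P : RV (n+1)} :
    P ∈ linSys n d s m tp ↔ P.IsHomogeneous d ∧ ∀ i, ∀ D : List (Fin (n+1)), D.length < m i →
      MvPolynomial.aeval (rncPoint n (tp i)) (derivAlong D P) = 0 := by
  simp [linSys, Submodule.mem_inf, Submodule.mem_iInf]

lemma m_le {n d s : ℕ} {m : Fin s → ℕ} {tp : Fin s → ℂ} (heff : linSys n d s m tp ≠ ⊥) (i : Fin s) :
    m i ≤ d := by
  by_contra hlt
  apply heff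
  rw [eq_bot_iff]
  intro P hP
  rw [Submodule.mem_bot]
  obtain ⟨hh, hv⟩ := mem_linSys.1 hP
  apply Pr_inj (n+1)
  rw [map_zero]
  apply dual_ext
  intro α
  by_cases hd : α.degree = d
  · obtain ⟨D, hD, hD'⟩ := mono_list α
    have h1 := derivAlong_hom hh D
    have : d - D.length = 0 := by omega
    rw [this] at h1
    have h2 := Pr_ell n (tp i) _ _ h1
    rw [hv i D (by omega), mul_zero, pow_zero, ← Pr_list, mul_one, ← hD'] at h2
    exact h2
  · exact Pr_conc hh _ _ (MvPolynomial.isHomogeneous_monomial _ rfl) hd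

lemma linSys_map {n d s : ℕ} {m : Fin s → ℕ} {tp : Fin s → ℂ} (hm : ∀ i, m i ≤ d)
    (a : ℂ → ℕ) (ha : ∀ i, a (tp i) = d + 1 - m i) :
    (linSys n d s m tp).map (Pr (n+1)).flip = Wd (n+1) d (univ.image tp) a := by
  ext l
  rw [Submodule.mem_map, mem_Wd]
  constructor
  · rintro ⟨P, hP, rfl⟩
    obtain ⟨hh, hv⟩ := mem_linSys.1 hP
    refine ⟨Pr_conc hh, ?_⟩
    intro t ht f
    obtain ⟨i, _, rfl⟩ := Finset.mem_image.1 ht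
    rw [ha]
    exact (vanish_iff hh (hm i) (tp i)).1 (hv i) f
  · rintro ⟨hc, hv⟩
    set P : RV (n+1) := ∑ α : Ix (n+1) d, MvPolynomial.monomial α.1 (l (MvPolynomial.monomial α.1 1) / af α.1) with hPdef
    have hh : P.IsHomogeneous d := by
      apply MvPolynomial.IsHomogeneous.sum
      intro α _
      exact MvPolynomial.isHomogeneous_monomial _ ((mem_ix α.1).1 α.2)
    have hl : (Pr (n+1)).flip P = l := by
      apply Pr_ext
      intro β
      by_cases hβ : β.degree = d
      · rw [LinearMap.flip_apply, Pr_mono, hPdef, MvPolynomial.coeff_sum, Finset.sum_eq_single ⟨β, (mem_ix β).2 hβ⟩]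
        · rw [MvPolynomial.coeff_monomial, if_pos rfl, mul_div_cancel₀ _ (af_ne β)]
        · intro α _ hα
          rw [MvPolynomial.coeff_monomial, if_neg]
          intro h; exact hα (Subtype.ext h)
        · simp
      · rw [Pr_conc hh _ _ (MvPolynomial.isHomogeneous_monomial _ rfl) hβ, hc _ _ (MvPolynomial.isHomogeneous_monomial _ rfl) hβ]
    refine ⟨P, mem_linSys.2 ⟨hh, ?_⟩, hl⟩
    intro i
    rw [vanish_iff hh (hm i) (tp i)]
    intro f
    have := hv (tp i) (Finset.mem_image_of_mem _ (Finset.mem_univ i)) f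
    rw [← hl, ha] at this
    exact this

/-- **Main Theorem (Theorem C).** For `s ≥ n+3` points on a rational normal curve of
degree `n` in `ℙⁿ`, if the linear system `L = L_{n,d}(m_1,…,m_s)` is effective and
non-redundant (`m_i ≥ k_C` for every `i`), then its dimension is
`Σ (−1)^{|I|} F_t(n + k_{I,t} − r_{I,t} − 1, s, ε, n)`, the sum ranging over all
`t` with `0 ≤ 2t ≤ n` and subsets `I ⊆ {1,…,s}` with `|I| ≤ n − 2t`. -/
theorem stmt_0 (n d s : ℕ) (hn : 2 ≤ n) (hs : n + 3 ≤ s)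
    (m : Fin s → ℕ) (tp : Fin s → ℂ) (htp : Function.Injective tp)
    (heff : linSys n d s m tp ≠ ⊥)
    (hred : ∀ i : Fin s, kC n d s m ≤ (m i : ℤ))
    (ε : ℕ) (hε : (ε : ℤ) ≤ (s : ℤ) - n - 3)
    (hεdef : ((s : ℤ) - n - 2) * kC n d s m = (∑ i, (m i : ℤ)) - (n : ℤ) * d + ε) :
    (Module.finrank ℂ (linSys n d s m tp) : ℤ) =
      ∑ t ∈ (Finset.range (n+1)).filter (fun t => 2 * t ≤ n),
        ∑ I ∈ Finset.univ.filter (fun I : Finset (Fin s) => I.card + 2 * t ≤ n),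
          (-1 : ℤ) ^ I.card *
            Fb t ((n : ℤ) +
                ((∑ i ∈ I, (m i : ℤ)) + (t : ℤ) * kC n d s m
                  - ((t : ℤ) + I.card - 1) * d)
                - ((I.card : ℤ) + 2 * t - 1) - 1)
              s ε n := by
  obtain ⟨q, rfl⟩ := Nat.exists_eq_add_of_le hs
  have hm := fun i => m_le heff i
  have hεq : ε ≤ q := by push_cast at hε; omega
  generalize hkk : kC n d (n+3+q) m = k at *
  have hkd : k ≤ d := by
    have h1 := hred ⟨0, by omega⟩
    have h2 := hm ⟨0, by omega⟩
    omega
  obtain ⟨κ, hκ⟩ : ∃ κ : ℕ, (κ : ℤ) = d - k + 1 := ⟨(d - k + 1).toNat, by omega⟩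
  have hκ0 : 0 < κ := by omega
  set b : Fin (n+3+q) → ℕ := fun i => d + 1 - m i with hb
  have hb1 : ∀ i, 0 < b i := fun i => by have := hm i; simp only [hb]; omega
  have hbm : ∀ i, (b i : ℤ) = d + 1 - m i := fun i => by have := hm i; simp only [hb]; omega
  set a : ℂ → ℕ := Function.extend tp b 0 with ha
  have hab : ∀ i, a (tp i) = b i := fun i => htp.extend_apply _ _ _
  set S : Finset ℂ := univ.image tp with hS
  have hTV : TV (n+1) (q-ε) (ε+1) d κ S a := by
    refine ⟨?_, ?_, ?_⟩
    · rw [hS, Finset.card_image_of_injective _ htp, Finset.card_univ, Fintype.card_fin]; omega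
    · rw [hS, Finset.sum_image (fun _ _ _ _ h => htp h)]
      simp only [hab]
      zify [hεq]
      simp only [hbm]
      rw [Finset.sum_sub_distrib, Finset.sum_const, Finset.card_univ, Fintype.card_fin, nsmul_eq_mul]
      have hk : k = d + 1 - κ := by omega
      rw [hk] at hεdef
      push_cast at hεdef ⊢
      linear_combination hεdef
    · intro t ht
      obtain ⟨i, _, rfl⟩ := Finset.mem_image.1 ht
      rw [hab]
      have := hred i
      have := hbm i
      omega
  have hmap := linSys_map (n := n) (tp := tp) hm a hab
  have hfin : (Module.finrank ℂ (linSys n d (n+3+q) m tp) : ℤ) = hW (n+1) d S a := by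
    unfold hW
    rw [← hmap, (Submodule.equivMapOfInjective _ (Pr_inj (n+1)) _).finrank_eq]
  obtain ⟨P, hP, hP0⟩ := (Submodule.ne_bot_iff _).1 heff
  have hl : (Pr (n+1)).flip P ∈ Wd (n+1) d S a := by
    rw [← hmap]; exact Submodule.mem_map_of_mem hP
  have hl0 : (Pr (n+1)).flip P ≠ 0 := fun h => hP0 (Pr_inj (n+1) (by rw [h, map_zero]))
  have htr : ∀ (I : Finset (Fin (n+3+q))) (t : ℕ), n + 1 ≤ I.card + 2 * t → d < ∑ i ∈ I, b i + t * κ := by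
    intro I t hI
    have h1 := trunc (Wd_le_conc _ _ _ _ hl) hl0 (I.image tp) t (fun z => a z - 1) (κ - 1) (by
      intro z hz f
      obtain ⟨i, _, rfl⟩ := Finset.mem_image.1 hz
      have : a (tp i) - 1 + 1 = a (tp i) := by rw [hab]; have := hb1 i; omega
      simp only [this]
      exact hl.2 _ (Finset.mem_image_of_mem _ (Finset.mem_univ i)) f) (by
      intro u f
      have : κ - 1 + 1 = κ := by omega
      rw [this]
      exact TV_base hTV hl u f) (by
      rw [Finset.card_image_of_injective _ htp]; exact hI)
    rw [Finset.sum_image (fun _ _ _ _ h => htp h)] at h1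
    have h2 : ∑ i ∈ I, (a (tp i) - 1) + I.card = ∑ i ∈ I, b i := by
      rw [Finset.card_eq_sum_ones, ← Finset.sum_add_distrib]
      apply Finset.sum_congr rfl
      intro i _
      rw [hab]; have := hb1 i; omega
    have h3 : t * (κ - 1) + t = t * κ := by
      obtain ⟨c, rfl⟩ := Nat.exists_eq_add_of_le' hκ0
      rw [Nat.add_sub_cancel]; ring
    omega
  have hT := T_main (n+1) (q-ε) ε d κ S a hTV
  have hNp : Np S a = ∏ i, (1 - (PowerSeries.X : PowerSeries ℤ) ^ b i) := by
    unfold Np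
    rw [hS, Finset.prod_image (fun _ _ _ _ h => htp h)]
    simp only [hab]
  rw [hfin, hT, BB, hNp, comb (n+3+q) n d κ ε q b hκ0 rfl hεq htr]
  apply Finset.sum_congr rfl
  intro t _
  apply Finset.sum_congr rfl
  intro I _
  congr 2
  rw [Nat.cast_sum]
  simp only [hbm]
  rw [Finset.sum_sub_distrib, Finset.sum_const, nsmul_eq_mul, hκ]
  ring

end
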